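/- arXiv:2001.11096 — 6 statements merged into one kernel-verified Lean document; each statement's English description precedes it below -/
import Mathlib

section
/- Let Ω ⊆ ℝ^d be a nonempty bounded open convex set with 0 ∈ Ω, let J be a nonempty convex subset of ∂Ω, and let x be a point of the intrinsic (relative) interior of J. Then the set J* = {f ∈ Ω° : f(z) = 1 for all z ∈ J} is nonempty, J* = {f ∈ Ω° : f(x) = 1}, and J* is an exposed face of the convex set Ω°. -/
open Set

noncomputable section

/-- `ℝ^d`. -/
abbrev Euc (d : ℕ) := EuclideanSpace ℝ (Fin d)

/-- The polar body `Ω° = {f : f(y) ≤ 1 for all y ∈ Ω}`. -/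
def polarBody {d : ℕ} (Ω : Set (Euc d)) : Set (Euc d →L[ℝ] ℝ) :=
  {f | ∀ y ∈ Ω, f y ≤ 1}

/-- The dual face `J* = {f ∈ Ω° : f(z) = 1 for all z ∈ J}` of a subset `J` of `∂Ω`. -/
def dualFace {d : ℕ} (Ω J : Set (Euc d)) : Set (Euc d →L[ℝ] ℝ) :=
  {f ∈ polarBody Ω | ∀ z ∈ J, f z = 1}

/-- A segment from a point `x` of the intrinsic interior of `s` to a point of `s` can be prolonged
beyond `x` inside `s`. -/
theorem exists_neg_lineMap_mem_of_mem_intrinsicInterior {E : Type*} [AddCommGroup E] [Module ℝ E]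
    [TopologicalSpace E] [IsTopologicalAddGroup E] [ContinuousSMul ℝ E] {s : Set E} {x z : E}
    (hx : x ∈ intrinsicInterior ℝ s) (hz : z ∈ s) :
    ∃ t : ℝ, t < 0 ∧ AffineMap.lineMap x z t ∈ s := by
  obtain ⟨y, hy, rfl⟩ := mem_intrinsicInterior.1 hx
  let g : ℝ → affineSpan ℝ s := fun t ↦
    ⟨AffineMap.lineMap (y : E) z t, AffineMap.lineMap_mem t y.2 (subset_affineSpan ℝ s hz)⟩
  have hg : Continuous g := AffineMap.lineMap_continuous.subtype_mk _
  have hg0 : g 0 = y := Subtype.ext (AffineMap.lineMap_apply_zero _ _)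
  have hev : ∀ᶠ t in nhds (0 : ℝ), g t ∈ ((↑) ⁻¹' s : Set (affineSpan ℝ s)) :=
    hg.continuousAt.eventually (hg0 ▸ mem_interior_iff_mem_nhds.1 hy)
  obtain ⟨t, ht, ht0⟩ :=
    ((hev.filter_mono nhdsWithin_le_nhds).and (self_mem_nhdsWithin (s := Set.Iio (0 : ℝ)))).exists
  exact ⟨t, ht0, ht⟩

theorem le_one_of_mem_polarBody_of_mem_closure {d : ℕ} {Ω : Set (Euc d)} {f : Euc d →L[ℝ] ℝ}
    (hf : f ∈ polarBody Ω) {z : Euc d} (hz : z ∈ closure Ω) : f z ≤ 1 :=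
  closure_minimal hf (isClosed_le f.continuous continuous_const) hz

/-- At a point outside an open convex neighbourhood `Ω` of `0`, some element of the polar body
takes the value `1`. -/
theorem exists_mem_polarBody_eq_one {d : ℕ} {Ω : Set (Euc d)} (hop : IsOpen Ω)
    (hconv : Convex ℝ Ω) (h0 : (0 : Euc d) ∈ Ω) {x : Euc d} (hx : x ∉ Ω) :
    ∃ f ∈ polarBody Ω, f x = 1 := by
  obtain ⟨f, hf⟩ := geometric_hahn_banach_open_point hconv hop hx
  have hpos : 0 < f x := by simpa using hf 0 h0
  refine ⟨(f x)⁻¹ • f, fun y hy ↦ ?_, by simp [hpos.ne']⟩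
  have := (inv_mul_le_one₀ hpos).2 (hf y hy).le
  simpa using this

theorem dualFace_eq_of_mem_intrinsicInterior {d : ℕ} {Ω J : Set (Euc d)} (hJ : J ⊆ closure Ω)
    {x : Euc d} (hx : x ∈ intrinsicInterior ℝ J) :
    dualFace Ω J = {f ∈ polarBody Ω | f x = 1} := by
  ext f
  refine ⟨fun hf ↦ ⟨hf.1, hf.2 x (intrinsicInterior_subset hx)⟩, fun ⟨hf, hfx⟩ ↦ ⟨hf, fun z hz ↦ ?_⟩⟩
  obtain ⟨t, ht, htJ⟩ := exists_neg_lineMap_mem_of_mem_intrinsicInterior hx hz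
  have hz1 := le_one_of_mem_polarBody_of_mem_closure hf (hJ hz)
  have ht1 := le_one_of_mem_polarBody_of_mem_closure hf (hJ htJ)
  simp only [AffineMap.lineMap_apply_module', map_add, map_smul, map_sub, hfx, smul_eq_mul] at ht1
  nlinarith

/-- For a nonempty convex subset `J` of `∂Ω` with a point `x` of intrinsic interior,
the dual face `J*` is nonempty, equals `{f ∈ Ω° : f(x) = 1}`, and is an exposed face
of the polar body `Ω°`. -/
theorem dualFace_nonempty_eq_and_exposed {d : ℕ}
    (Ω : Set (Euc d)) (hne : Ω.Nonempty) (hbd : Bornology.IsBounded Ω)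
    (hop : IsOpen Ω) (hconv : Convex ℝ Ω) (h0 : (0 : Euc d) ∈ Ω)
    (J : Set (Euc d)) (hJne : J.Nonempty) (hJconv : Convex ℝ J)
    (hJbd : J ⊆ closure Ω \ Ω)
    (x : Euc d) (hx : x ∈ intrinsicInterior ℝ J) :
    (dualFace Ω J).Nonempty ∧
    dualFace Ω J = {f ∈ polarBody Ω | f x = 1} ∧
    IsExposed ℝ (polarBody Ω) (dualFace Ω J) := by
  have heq := dualFace_eq_of_mem_intrinsicInterior (fun z hz ↦ (hJbd hz).1) hx
  have hxJ := hJbd (intrinsicInterior_subset hx)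
  obtain ⟨f, hf, hfx⟩ := exists_mem_polarBody_eq_one hop hconv h0 hxJ.2
  refine ⟨heq ▸ ⟨f, hf, hfx⟩, heq, fun _ ↦ ⟨ContinuousLinearMap.apply ℝ ℝ x, ?_⟩⟩
  rw [heq]
  ext g
  simp only [mem_ofPred_eq, ContinuousLinearMap.apply_apply]
  refine and_congr_right fun hg ↦ ⟨fun hgx k hk ↦ ?_, fun h ↦ ?_⟩
  · exact hgx ▸ le_one_of_mem_polarBody_of_mem_closure hk hxJ.1
  · exact (le_one_of_mem_polarBody_of_mem_closure hg hxJ.1).antisymm (hfx ▸ h f hf)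
end
end

section
/- Let Ω ⊆ ℝ^d be a nonempty bounded open convex set and let K and L be faces of Ω. Then exactly one of the following holds: (1) L = K; (2) L ∩ K = ∅; (3) L ⊆ ∂K or K ⊆ ∂L; (4) int(L) ∩ K = ∅, int(K) ∩ L = ∅, and L ∩ K is a nonempty face of Ω. -/
open Set

noncomputable section

/-- A face of `Ω`: a nonempty intersection of `∂Ω = closure Ω \ Ω` with an affine
hyperplane `{f = c}` disjoint from `Ω`. -/
def IsFace {d : ℕ} (Ω K : Set (Euc d)) : Prop :=
  K.Nonempty ∧ ∃ (f : Euc d →L[ℝ] ℝ) (c : ℝ), f ≠ 0 ∧ (∀ y ∈ Ω, f y ≠ c) ∧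
    K = {x | f x = c} ∩ (closure Ω \ Ω)

/-- Case (1): the faces are equal. -/
def FaceCase₁ {d : ℕ} (K L : Set (Euc d)) : Prop := L = K

/-- Case (2): the faces are disjoint. -/
def FaceCase₂ {d : ℕ} (K L : Set (Euc d)) : Prop := L ∩ K = ∅

/-- Case (3): one face is contained in the boundary `∂K = K \ int K` of the other. -/
def FaceCase₃ {d : ℕ} (K L : Set (Euc d)) : Prop :=
  L ⊆ K \ intrinsicInterior ℝ K ∨ K ⊆ L \ intrinsicInterior ℝ L

/-- Case (4): the intrinsic interiors miss each other and the intersection is a face. -/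
def FaceCase₄ {d : ℕ} (Ω K L : Set (Euc d)) : Prop :=
  intrinsicInterior ℝ L ∩ K = ∅ ∧ intrinsicInterior ℝ K ∩ L = ∅ ∧
    (L ∩ K).Nonempty ∧ IsFace Ω (L ∩ K)

/-- A set can be prolonged a little beyond any point of its intrinsic interior. -/
lemma exists_lineMap_mem_of_mem_intrinsicInterior {V : Type*} [NormedAddCommGroup V]
    [NormedSpace ℝ V] {s : Set V} {x y : V} (hx : x ∈ intrinsicInterior ℝ s) (hy : y ∈ s) :
    ∃ t : ℝ, 1 < t ∧ AffineMap.lineMap y x t ∈ s := by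
  obtain ⟨x', hx', rfl⟩ := mem_intrinsicInterior.1 hx
  have hline (t : ℝ) : AffineMap.lineMap y (x' : V) t ∈ affineSpan ℝ s :=
    AffineMap.lineMap_mem t (subset_affineSpan ℝ s hy) x'.2
  let γ : ℝ → affineSpan ℝ s := fun t ↦ ⟨AffineMap.lineMap y (x' : V) t, hline t⟩
  have hγ : Continuous γ := AffineMap.lineMap_continuous.subtype_mk _
  have hγ_one : γ 1 = x' := Subtype.ext (AffineMap.lineMap_apply_one _ _)
  have hmem : ∀ᶠ t in nhds (1 : ℝ), γ t ∈ interior ((↑) ⁻¹' s : Set (affineSpan ℝ s)) :=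
    hγ.continuousAt.eventually_mem (isOpen_interior.mem_nhds (hγ_one ▸ hx'))
  obtain ⟨t, ht, ht_one⟩ :=
    ((hmem.filter_mono nhdsWithin_le_nhds).and (self_mem_nhdsWithin (s := Ioi (1 : ℝ)))).exists
  have hmem_t : γ t ∈ ((↑) ⁻¹' s : Set (affineSpan ℝ s)) := interior_subset ht
  exact ⟨t, ht_one, hmem_t⟩

/-- A functional attaining its maximum over `s` in the intrinsic interior is constant on `s`. -/
lemma eq_of_mem_intrinsicInterior_of_le {V : Type*} [NormedAddCommGroup V] [NormedSpace ℝ V]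
    {s : Set V} {f : V →L[ℝ] ℝ} {c : ℝ} {x y : V} (hle : ∀ z ∈ s, f z ≤ c)
    (hx : x ∈ intrinsicInterior ℝ s) (hfx : f x = c) (hy : y ∈ s) : f y = c := by
  obtain ⟨t, ht, hmem⟩ := exists_lineMap_mem_of_mem_intrinsicInterior hx hy
  have h := hle _ hmem
  rw [AffineMap.lineMap_apply_module, map_add, map_smul, map_smul, hfx, smul_eq_mul,
    smul_eq_mul] at h
  have hy' := hle y hy
  nlinarith

/-- Faces are the nonempty maximum sets over the closure of functionals that stay strictly
below their maximum on `Ω`. -/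
lemma isFace_iff {d : ℕ} {Ω K : Set (Euc d)} (hne : Ω.Nonempty) (hconv : Convex ℝ Ω) :
    IsFace Ω K ↔ K.Nonempty ∧ ∃ (f : Euc d →L[ℝ] ℝ) (c : ℝ), (∀ y ∈ Ω, f y < c) ∧
      K = {x | f x = c} ∩ closure Ω := by
  refine and_congr_right fun hKne ↦ ⟨?_, ?_⟩
  · rintro ⟨f, c, -, hmiss, hK⟩
    have hK' : K = {x | f x = c} ∩ closure Ω := by
      rw [hK]
      ext x
      exact ⟨fun h ↦ ⟨h.1, h.2.1⟩, fun h ↦ ⟨h.1, h.2, fun hx ↦ hmiss x hx h.1⟩⟩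
    have hord : OrdConnected (f '' Ω) :=
      (hconv.isPreconnected.image f f.continuous.continuousOn).ordConnected
    have hc : c ∉ f '' Ω := by
      rintro ⟨y, hy, hfy⟩
      exact hmiss y hy hfy
    by_cases hlt : ∀ y ∈ Ω, f y < c
    · exact ⟨f, c, hlt, hK'⟩
    · push Not at hlt
      obtain ⟨z, hz, hcz⟩ := hlt
      refine ⟨-f, -c, fun y hy ↦ ?_, ?_⟩
      · by_contra! h
        exact hc (hord.out (mem_image_of_mem f hy) (mem_image_of_mem f hz)
          ⟨by simpa using h, hcz⟩)
      · simpa using hK'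
  · rintro ⟨f, c, hlt, hK⟩
    refine ⟨f, c, ?_, fun y hy ↦ (hlt y hy).ne, ?_⟩
    · rintro rfl
      obtain ⟨x, hx⟩ := hKne
      obtain ⟨y, hy⟩ := hne
      rw [hK] at hx
      exact (hlt y hy).ne hx.1
    · rw [hK]
      ext x
      exact ⟨fun h ↦ ⟨h.1, h.2, fun hx ↦ (hlt x hx).ne h.1⟩, fun h ↦ ⟨h.1, h.2.1⟩⟩

lemma le_of_mem_closure {V : Type*} [NormedAddCommGroup V] [NormedSpace ℝ V] {s : Set V}
    {f : V →L[ℝ] ℝ} {c : ℝ} (hlt : ∀ y ∈ s, f y < c) {x : V} (hx : x ∈ closure s) : f x ≤ c :=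
  closure_minimal (t := {z | f z ≤ c}) (fun y hy ↦ (hlt y hy).le)
    (isClosed_le f.continuous continuous_const) hx

namespace IsFace

variable {d : ℕ} {Ω K L : Set (Euc d)}

lemma convex (hK : IsFace Ω K) (hne : Ω.Nonempty) (hconv : Convex ℝ Ω) : Convex ℝ K := by
  obtain ⟨-, f, c, -, rfl⟩ := (isFace_iff hne hconv).1 hK
  exact (convex_hyperplane f.toLinearMap.isLinear c).inter hconv.closure

lemma intrinsicInterior_nonempty (hK : IsFace Ω K) (hne : Ω.Nonempty) (hconv : Convex ℝ Ω) :
    (intrinsicInterior ℝ K).Nonempty :=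
  Set.Nonempty.intrinsicInterior (hK.convex hne hconv) hK.1

/-- A face containing an intrinsic interior point of another face contains that face. -/
lemma subset_of_intrinsicInterior_inter_nonempty (hne : Ω.Nonempty) (hconv : Convex ℝ Ω)
    (hK : IsFace Ω K) (hL : IsFace Ω L) (h : (intrinsicInterior ℝ L ∩ K).Nonempty) : L ⊆ K := by
  obtain ⟨-, f, c, hlt, rfl⟩ := (isFace_iff hne hconv).1 hK
  have hLcl : L ⊆ closure Ω := by
    obtain ⟨-, g, e, -, rfl⟩ := (isFace_iff hne hconv).1 hL
    exact inter_subset_right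
  obtain ⟨x, hxL, hxK⟩ := h
  exact fun y hy ↦ ⟨eq_of_mem_intrinsicInterior_of_le
    (fun z hz ↦ le_of_mem_closure hlt (hLcl hz)) hxL hxK.1 hy, hLcl hy⟩

lemma inter (hne : Ω.Nonempty) (hconv : Convex ℝ Ω) (hK : IsFace Ω K) (hL : IsFace Ω L)
    (h : (K ∩ L).Nonempty) : IsFace Ω (K ∩ L) := by
  obtain ⟨-, f, c, hf, rfl⟩ := (isFace_iff hne hconv).1 hK
  obtain ⟨-, g, e, hg, rfl⟩ := (isFace_iff hne hconv).1 hL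
  refine (isFace_iff hne hconv).2 ⟨h, f + g, c + e, fun y hy ↦ add_lt_add (hf y hy) (hg y hy), ?_⟩
  ext x
  constructor
  · rintro ⟨⟨hfx, hx⟩, hgx, -⟩
    exact ⟨congrArg₂ (· + ·) hfx hgx, hx⟩
  · rintro ⟨hx, hxcl⟩
    have hfx := le_of_mem_closure hf hxcl
    have hgx := le_of_mem_closure hg hxcl
    have hsum : f x + g x = c + e := hx
    exact ⟨⟨by simp only [mem_ofPred_eq]; linarith, hxcl⟩,
      ⟨by simp only [mem_ofPred_eq]; linarith, hxcl⟩⟩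

end IsFace

/-- The 4-chotomy: two faces of `Ω` satisfy exactly one of the four cases. -/
theorem face_fourchotomy {d : ℕ}
    (Ω : Set (Euc d)) (hne : Ω.Nonempty) (hbd : Bornology.IsBounded Ω)
    (hop : IsOpen Ω) (hconv : Convex ℝ Ω)
    (K L : Set (Euc d)) (hK : IsFace Ω K) (hL : IsFace Ω L) :
    (FaceCase₁ K L ∨ FaceCase₂ K L ∨ FaceCase₃ K L ∨ FaceCase₄ Ω K L) ∧
    ¬ (FaceCase₁ K L ∧ FaceCase₂ K L) ∧
    ¬ (FaceCase₁ K L ∧ FaceCase₃ K L) ∧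
    ¬ (FaceCase₁ K L ∧ FaceCase₄ Ω K L) ∧
    ¬ (FaceCase₂ K L ∧ FaceCase₃ K L) ∧
    ¬ (FaceCase₂ K L ∧ FaceCase₄ Ω K L) ∧
    ¬ (FaceCase₃ K L ∧ FaceCase₄ Ω K L) := by
  have hiK := hK.intrinsicInterior_nonempty hne hconv
  have hiL := hL.intrinsicInterior_nonempty hne hconv
  have hsK : intrinsicInterior ℝ K ⊆ K := intrinsicInterior_subset
  have hsL : intrinsicInterior ℝ L ⊆ L := intrinsicInterior_subset
  refine ⟨?_, ?_, ?_, ?_, ?_, ?_, ?_⟩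
  · rcases (intrinsicInterior ℝ L ∩ K).eq_empty_or_nonempty with hLK | hLK
    · rcases (intrinsicInterior ℝ K ∩ L).eq_empty_or_nonempty with hKL | hKL
      · rcases (L ∩ K).eq_empty_or_nonempty with h | h
        · exact Or.inr (Or.inl h)
        · exact Or.inr (Or.inr (Or.inr ⟨hLK, hKL, h, hL.inter hne hconv hK h⟩))
      · have hsub := IsFace.subset_of_intrinsicInterior_inter_nonempty hne hconv hL hK hKL
        exact Or.inr (Or.inr (Or.inl (Or.inr fun x hx ↦
          ⟨hsub hx, fun hxi ↦ (hLK.subset ⟨hxi, hx⟩ : x ∈ (∅ : Set _))⟩)))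
    · have hsub := IsFace.subset_of_intrinsicInterior_inter_nonempty hne hconv hK hL hLK
      rcases (intrinsicInterior ℝ K ∩ L).eq_empty_or_nonempty with hKL | hKL
      · exact Or.inr (Or.inr (Or.inl (Or.inl fun x hx ↦
          ⟨hsub hx, fun hxi ↦ (hKL.subset ⟨hxi, hx⟩ : x ∈ (∅ : Set _))⟩)))
      · exact Or.inl (hsub.antisymm
          (IsFace.subset_of_intrinsicInterior_inter_nonempty hne hconv hL hK hKL))
  · rintro ⟨rfl, h⟩
    exact hL.1.ne_empty (by simpa [FaceCase₂] using h)
  · rintro ⟨rfl, h⟩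
    obtain ⟨x, hx⟩ := hiL
    exact h.elim (fun h ↦ (h (hsL hx)).2 hx) fun h ↦ (h (hsL hx)).2 hx
  · rintro ⟨rfl, h, -⟩
    obtain ⟨x, hx⟩ := hiL
    exact h.subset ⟨hx, hsL hx⟩
  · rintro ⟨h, h' | h'⟩
    · obtain ⟨x, hx⟩ := hL.1
      exact h.subset ⟨hx, (h' hx).1⟩
    · obtain ⟨x, hx⟩ := hK.1
      exact h.subset ⟨(h' hx).1, hx⟩
  · rintro ⟨h, -, -, h', -⟩
    exact h'.ne_empty h
  · rintro ⟨h | h, hLK, hKL, -⟩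
    · obtain ⟨x, hx⟩ := hiL
      exact hLK.subset ⟨hx, (h (hsL hx)).1⟩
    · obtain ⟨x, hx⟩ := hiK
      exact hKL.subset ⟨hx, (h (hsK hx)).1⟩
end
end

section
/- Let Ω ⊆ ℝ^d be a nonempty bounded open convex set with 0 ∈ Ω, and let K and L be faces of Ω with K ⊆ ∂L. Then L* ⊆ K* and L* ∩ int(K*) = ∅, where for a face J of Ω we write J* = {f ∈ Ω° : f(z) = 1 for all z ∈ J}. -/
open Set

noncomputable section

/-- From a point of the intrinsic interior, any segment issuing from a point of the set can be
prolonged slightly within the set. -/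
theorem exists_pos_lineMap_neg_mem_of_mem_intrinsicInterior {E : Type*} [NormedAddCommGroup E]
    [NormedSpace ℝ E] {s : Set E} {x y : E} (hx : x ∈ intrinsicInterior ℝ s) (hy : y ∈ s) :
    ∃ t : ℝ, 0 < t ∧ AffineMap.lineMap x y (-t) ∈ s := by
  obtain ⟨x, hxs, rfl⟩ := mem_intrinsicInterior.1 hx
  let γ : ℝ → affineSpan ℝ s := fun t ↦
    ⟨AffineMap.lineMap (x : E) y (-t),
      AffineMap.lineMap_mem _ x.2 (subset_affineSpan ℝ s hy)⟩
  have hγ : Continuous γ := by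
    refine Continuous.subtype_mk ?_ _
    exact AffineMap.lineMap_continuous.comp continuous_neg
  have hγ0 : γ 0 = x := by
    apply Subtype.ext
    simp [γ]
  have hev : ∀ᶠ t in nhds (0 : ℝ), γ t ∈ interior ((↑) ⁻¹' s : Set (affineSpan ℝ s)) :=
    hγ.continuousAt.eventually_mem (isOpen_interior.mem_nhds (hγ0.symm ▸ hxs))
  obtain ⟨ε, hε, h⟩ := Metric.eventually_nhds_iff.1 hev
  refine ⟨ε / 2, half_pos hε, ?_⟩
  suffices hd : dist (ε / 2) 0 < ε from
    interior_subset (s := ((↑) ⁻¹' s : Set (affineSpan ℝ s))) (h hd)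
  rw [Real.dist_eq, sub_zero, abs_of_pos (half_pos hε)]
  exact half_lt_self hε

theorem dualFace_anti {d : ℕ} {Ω K L : Set (Euc d)} (h : K ⊆ L) :
    dualFace Ω L ⊆ dualFace Ω K :=
  fun _ hf ↦ ⟨hf.1, fun z hz ↦ hf.2 z (h hz)⟩

theorem IsFace.subset_frontier {d : ℕ} {Ω K : Set (Euc d)} (hK : IsFace Ω K) :
    K ⊆ closure Ω \ Ω := by
  obtain ⟨-, f, c, -, -, rfl⟩ := hK
  exact inter_subset_right

theorem IsFace.convex_s3 {d : ℕ} {Ω K : Set (Euc d)} (hΩ : Convex ℝ Ω) (hK : IsFace Ω K) :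
    Convex ℝ K := by
  obtain ⟨-, f, c, -, hf, rfl⟩ := hK
  have h : {x | f x = c} ∩ (closure Ω \ Ω) = {x | f x = c} ∩ closure Ω := by
    ext x
    exact ⟨fun hx ↦ ⟨hx.1, hx.2.1⟩, fun hx ↦ ⟨hx.1, hx.2, fun hxΩ ↦ hf x hxΩ hx.1⟩⟩
  rw [h]
  exact (convex_hyperplane f.toLinearMap.isLinear c).inter hΩ.closure

/-- A face is cut out by some element of its dual face. -/
theorem IsFace.exists_mem_dualFace {d : ℕ} {Ω K : Set (Euc d)} (hΩ : Convex ℝ Ω)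
    (h0 : (0 : Euc d) ∈ Ω) (hK : IsFace Ω K) :
    ∃ g ∈ dualFace Ω K, ∀ z ∈ closure Ω \ Ω, g z = 1 → z ∈ K := by
  obtain ⟨-, f, c, -, hf, rfl⟩ := hK
  have hc : c ≠ 0 := fun h ↦ hf 0 h0 (by simp [h])
  refine ⟨c⁻¹ • f, ⟨fun y hy ↦ ?_, fun z hz ↦ ?_⟩, fun z hz hgz ↦ ⟨?_, hz⟩⟩
  · by_contra! hlt
    obtain ⟨x, hx, hx1⟩ := hΩ.isPreconnected.intermediate_value h0 hy
      (c⁻¹ • f).continuous.continuousOn ⟨by simp, hlt.le⟩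
    refine hf x hx ?_
    simpa [inv_mul_eq_one₀ hc, eq_comm] using hx1
  · have : f z = c := hz.1
    simp [this, hc]
  · simpa [inv_mul_eq_one₀ hc, eq_comm] using hgz

/-- Duality reverses inclusion of faces: if `K ⊆ ∂L` then `L* ⊆ K*`, with `L*` missing
the intrinsic interior of `K*`. -/
theorem dualFace_reverses_inclusion {d : ℕ}
    (Ω : Set (Euc d)) (hne : Ω.Nonempty) (hbd : Bornology.IsBounded Ω)
    (hop : IsOpen Ω) (hconv : Convex ℝ Ω) (h0 : (0 : Euc d) ∈ Ω)
    (K L : Set (Euc d)) (hK : IsFace Ω K) (hL : IsFace Ω L)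
    (hKL : K ⊆ L \ intrinsicInterior ℝ L) :
    dualFace Ω L ⊆ dualFace Ω K ∧
    dualFace Ω L ∩ intrinsicInterior ℝ (dualFace Ω K) = ∅ := by
  have hsub : K ⊆ L := fun z hz ↦ (hKL hz).1
  refine ⟨dualFace_anti hsub, eq_empty_iff_forall_notMem.2 ?_⟩
  rintro f ⟨hfL, hfK⟩
  obtain ⟨g, hgK, hg⟩ := hK.exists_mem_dualFace hconv h0
  obtain ⟨z, hz⟩ := (intrinsicInterior_nonempty (hL.convex_s3 hconv)).2 hL.1
  have hzL : z ∈ L := intrinsicInterior_subset hz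
  have hzΩ := hL.subset_frontier hzL
  have hgz : g z < 1 := (le_one_of_mem_polarBody_of_mem_closure hgK.1 hzΩ.1).lt_of_ne
    fun h ↦ (hKL (hg z hzΩ h)).2 hz
  obtain ⟨t, ht, hmem⟩ := exists_pos_lineMap_neg_mem_of_mem_intrinsicInterior hfK hgK
  have hle := le_one_of_mem_polarBody_of_mem_closure hmem.1 hzΩ.1
  have hfz : f z = 1 := hfL.2 z hzL
  simp only [AffineMap.lineMap_apply, vsub_eq_sub, vadd_eq_add, add_apply, smul_apply,
    sub_apply, smul_eq_mul, hfz] at hle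
  nlinarith
end
end

section
/- Let Ω ⊆ ℝ^d be a nonempty bounded open convex set. Let (aᵢ) and (bᵢ) be sequences in Ω with aᵢ ≠ bᵢ for all i, converging respectively to points a∞ and b∞ of ∂Ω with a∞ ≠ b∞. For each i let zᵢ, wᵢ ∈ ∂Ω be collinear with aᵢ, bᵢ, with aᵢ strictly between zᵢ and bᵢ and bᵢ strictly between aᵢ and wᵢ, and assume zᵢ → z∞ and wᵢ → w∞. If there is N such that [zᵢ, aᵢ, bᵢ, wᵢ] ≤ N for all i, then z∞, a∞, b∞, w∞ are four pairwise distinct collinear points of ∂Ω, and the closed segment [z∞, w∞] is contained in ∂Ω and strictly contains the segment [a∞, b∞]. -/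
open Set Filter

noncomputable section

/-- The cross-ratio of four collinear points, `a` strictly between `z` and `b`,
`b` strictly between `a` and `w`. -/
def crossRatio {d : ℕ} (z a b w : Euc d) : ℝ :=
  (‖z - b‖ * ‖a - w‖) / (‖z - a‖ * ‖b - w‖)

/-- Weak betweenness passes to limits in a strictly convex space. -/
theorem wbtw_of_tendsto {E : Type*} [NormedAddCommGroup E] [NormedSpace ℝ E]
    [StrictConvexSpace ℝ E] {x y z : ℕ → E} {xl yl zl : E}
    (hx : Tendsto x atTop (nhds xl)) (hy : Tendsto y atTop (nhds yl))
    (hz : Tendsto z atTop (nhds zl)) (h : ∀ i, Wbtw ℝ (x i) (y i) (z i)) :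
    Wbtw ℝ xl yl zl := by
  rw [← dist_add_dist_eq_iff]
  refine tendsto_nhds_unique ((hx.dist hy).add (hy.dist hz)) ?_
  simpa only [(h _).dist_add_dist] using hx.dist hz

/-- A segment between two points of the closure of an open convex set `s` which meets the
complement of `s` in a relative interior point stays in the boundary of `s`. -/
theorem segment_subset_closure_diff_of_sbtw {E : Type*} [NormedAddCommGroup E] [NormedSpace ℝ E]
    {s : Set E} (hs : Convex ℝ s) (hop : IsOpen s) {x y z : E} (hx : x ∈ closure s)
    (hz : z ∈ closure s) (hy : y ∉ s) (h : Sbtw ℝ x y z) :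
    segment ℝ x z ⊆ closure s \ s := by
  intro p hp
  refine ⟨hs.closure.segment_subset hx hz hp, fun hps => ?_⟩
  obtain ⟨f, hf⟩ := geometric_hahn_banach_open_point hs hop hy
  have hle : ∀ q ∈ closure s, f q ≤ f y := fun q hq =>
    closure_minimal (fun r hr => (hf r hr).le) (isClosed_le f.continuous continuous_const) hq
  have hfx := hle x hx
  have hfz := hle z hz
  have hfp := hf p hps
  have hyo : y ∈ openSegment ℝ x z :=
    mem_openSegment_of_ne_left_right h.left_ne h.ne_right.symm (mem_segment_iff_wbtw.2 h.wbtw)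
  obtain ⟨α, β, hα, hβ, hαβ, hyeq⟩ := hyo
  obtain ⟨γ, δ, hγ, hδ, hγδ, rfl⟩ := hp
  have hfy : α * f x + β * f z = f y := by
    rw [← hyeq]; simp
  have hyy : α * f y + β * f y = f y := by rw [← add_mul, hαβ, one_mul]
  have hfp' : γ * f x + δ * f z < f y := by simpa using hfp
  have hxy : f x = f y := by
    refine hfx.antisymm (le_of_not_gt fun hlt => ?_)
    nlinarith [mul_pos hα (sub_pos.2 hlt), mul_nonneg hβ.le (sub_nonneg.2 hfz)]
  have hzy : f z = f y := by
    refine hfz.antisymm (le_of_not_gt fun hlt => ?_)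
    nlinarith [mul_pos hβ (sub_pos.2 hlt), mul_nonneg hα.le (sub_nonneg.2 hfx)]
  rw [hxy, hzy, ← add_mul, hγδ, one_mul] at hfp'
  exact lt_irrefl _ hfp'

/-- If two sequences in `Ω` converge to distinct boundary points while staying at bounded
cross-ratio (Hilbert distance), then the limits lie on a segment of `∂Ω` which strictly
contains them. -/
theorem bounded_crossRatio_limits_give_boundary_segment {d : ℕ}
    (Ω : Set (Euc d)) (hne : Ω.Nonempty) (hbd : Bornology.IsBounded Ω)
    (hop : IsOpen Ω) (hconv : Convex ℝ Ω)
    (a b z w : ℕ → Euc d) (al bl zl wl : Euc d)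
    (ha : ∀ i, a i ∈ Ω) (hb : ∀ i, b i ∈ Ω) (hab : ∀ i, a i ≠ b i)
    (hz : ∀ i, z i ∈ closure Ω \ Ω) (hw : ∀ i, w i ∈ closure Ω \ Ω)
    (hbet₁ : ∀ i, a i ∈ openSegment ℝ (z i) (b i))
    (hbet₂ : ∀ i, b i ∈ openSegment ℝ (a i) (w i))
    (hal : Tendsto a atTop (nhds al)) (hbl : Tendsto b atTop (nhds bl))
    (hzl : Tendsto z atTop (nhds zl)) (hwl : Tendsto w atTop (nhds wl))
    (halb : al ∈ closure Ω \ Ω) (hblb : bl ∈ closure Ω \ Ω) (halbl : al ≠ bl)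
    (N : ℝ) (hN : ∀ i, crossRatio (z i) (a i) (b i) (w i) ≤ N) :
    zl ∈ closure Ω \ Ω ∧ wl ∈ closure Ω \ Ω ∧
    zl ≠ al ∧ zl ≠ bl ∧ zl ≠ wl ∧ al ≠ wl ∧ bl ≠ wl ∧
    Collinear ℝ {zl, al, bl, wl} ∧
    segment ℝ zl wl ⊆ closure Ω \ Ω ∧
    segment ℝ al bl ⊂ segment ℝ zl wl := by
  have hcl : IsClosed (closure Ω \ Ω) := hop.frontier_eq ▸ isClosed_frontier
  have hzlb : zl ∈ closure Ω \ Ω := hcl.mem_of_tendsto hzl (Eventually.of_forall hz)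
  have hwlb : wl ∈ closure Ω \ Ω := hcl.mem_of_tendsto hwl (Eventually.of_forall hw)
  have hzab : Wbtw ℝ zl al bl := wbtw_of_tendsto hzl hal hbl fun i =>
    mem_segment_iff_wbtw.1 (openSegment_subset_segment ℝ _ _ (hbet₁ i))
  have habw : Wbtw ℝ al bl wl := wbtw_of_tendsto hal hbl hwl fun i =>
    mem_segment_iff_wbtw.1 (openSegment_subset_segment ℝ _ _ (hbet₂ i))
  have hcross : ‖zl - bl‖ * ‖al - wl‖ ≤ N * (‖zl - al‖ * ‖bl - wl‖) := by
    refine le_of_tendsto_of_tendsto'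
      ((hzl.sub hbl).norm.mul (hal.sub hwl).norm)
      (((hzl.sub hal).norm.mul (hbl.sub hwl).norm).const_mul N) fun i => ?_
    have hza : z i ≠ a i := fun h => (hz i).2 (h ▸ ha i)
    have hbw : b i ≠ w i := fun h => (hw i).2 (h ▸ hb i)
    exact (div_le_iff₀ (mul_pos (norm_pos_iff.2 (sub_ne_zero.2 hza))
      (norm_pos_iff.2 (sub_ne_zero.2 hbw)))).1 (hN i)
  have hzbl : zl ≠ bl := by
    rintro rfl
    exact halbl ((wbtw_self_iff ℝ).1 hzab)
  have hawl : al ≠ wl := by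
    rintro rfl
    exact halbl ((wbtw_self_iff ℝ).1 habw).symm
  have hpos : 0 < ‖zl - bl‖ * ‖al - wl‖ :=
    mul_pos (norm_pos_iff.2 (sub_ne_zero.2 hzbl)) (norm_pos_iff.2 (sub_ne_zero.2 hawl))
  have hzal : zl ≠ al := by
    rintro rfl
    simp only [sub_self, norm_zero, zero_mul, mul_zero] at hcross
    exact hcross.not_gt hpos
  have hbwl : bl ≠ wl := by
    rintro rfl
    simp only [sub_self, norm_zero, mul_zero] at hcross
    exact hcross.not_gt hpos
  have hzaw : Wbtw ℝ zl al wl := hzab.trans_expand_left habw halbl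
  have hzbw : Wbtw ℝ zl bl wl := hzab.trans_expand_right habw halbl
  have hzwl : zl ≠ wl := by
    rintro rfl
    exact hzal ((wbtw_self_iff ℝ).1 hzaw).symm
  refine ⟨hzlb, hwlb, hzal, hzbl, hzwl, hawl, hbwl, ?_, ?_, ?_, ?_⟩
  · refine (collinear_insert_insert_of_mem_affineSpan_pair hzaw.mem_affineSpan
      hzbw.mem_affineSpan).subset ?_
    simp [insert_subset_iff]
  · exact segment_subset_closure_diff_of_sbtw hconv hop hzlb.1 hwlb.1 halb.2
      ⟨hzaw, hzal.symm, hawl⟩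
  · exact (convex_segment zl wl).segment_subset (mem_segment_iff_wbtw.2 hzaw)
      (mem_segment_iff_wbtw.2 hzbw)
  · intro hsub
    have hazb := mem_segment_iff_wbtw.1 (hsub (left_mem_segment ℝ zl wl))
    have h₁ := hazb.dist_add_dist
    have h₂ := hzab.dist_add_dist
    rw [dist_comm al zl] at h₁
    linarith [dist_pos.2 hzal]
end
end

section
/- Let g ∈ GL(d+1, ℝ) be a linear automorphism of ℝ^{d+1} that maps the open positive orthant O = {v ∈ ℝ^{d+1} : vᵢ > 0 for all i} onto itself. Then there exist a permutation σ of {1,…,d+1} and positive real numbers λ₁,…,λ_{d+1} such that g(eᵢ) = λᵢ·e_{σ(i)} for every i, where e₁,…,e_{d+1} is the standard basis; that is, g is the product of a positive diagonal matrix and a permutation matrix. -/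
open Set

noncomputable section

/-- By continuity, a linear map that preserves the open positive orthant preserves the closed one. -/
lemma nonneg_of_forall_pos {ι : Type*}
    (f : EuclideanSpace ℝ ι →ₗ[ℝ] EuclideanSpace ℝ ι)
    (hf : ∀ v : EuclideanSpace ℝ ι, (∀ i, 0 < v i) → ∀ i, 0 < f v i)
    (v : EuclideanSpace ℝ ι) (hv : ∀ i, 0 ≤ v i) (i : ι) : 0 ≤ f v i := by
  let u : EuclideanSpace ℝ ι := WithLp.toLp 2 fun _ => 1
  have hu : 0 < f u i := hf u (fun _ => one_pos) i
  by_contra! h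
  have hε : 0 < -(f v i) / f u i := div_pos (neg_pos.2 h) hu
  have := hf (v + (-(f v i) / f u i) • u) (fun k => by
    simpa [u] using add_pos_of_nonneg_of_pos (hv k) hε) i
  simp [hu.ne'] at this

/-- A linear automorphism preserving the closed orthant in both directions permutes the coordinate
rays. -/
lemma exists_single_eq_smul_single {ι : Type*} [DecidableEq ι]
    (g : EuclideanSpace ℝ ι ≃ₗ[ℝ] EuclideanSpace ℝ ι)
    (hg : ∀ v : EuclideanSpace ℝ ι, (∀ i, 0 ≤ v i) → ∀ i, 0 ≤ g v i)
    (hg' : ∀ v : EuclideanSpace ℝ ι, (∀ i, 0 ≤ v i) → ∀ i, 0 ≤ g.symm v i) (j : ι) :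
    ∃ (i : ι) (c : ℝ), 0 < c ∧
      g (EuclideanSpace.single j (1 : ℝ)) = c • EuclideanSpace.single i (1 : ℝ) := by
  have single_nonneg (j k : ι) : 0 ≤ EuclideanSpace.single j (1 : ℝ) k := by
    rw [PiLp.single_apply]
    split_ifs <;> norm_num
  have single_ne (j : ι) : EuclideanSpace.single j (1 : ℝ) ≠ 0 := by simp
  have hnn := hg _ (single_nonneg j)
  obtain ⟨i, hi⟩ : ∃ i, 0 < g (EuclideanSpace.single j (1 : ℝ)) i := by
    by_contra! h
    refine single_ne j (g.map_eq_zero_iff.1 ?_)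
    ext i
    exact le_antisymm (h i) (hnn i)
  set c := g (EuclideanSpace.single j (1 : ℝ)) i with hc
  have hnn' := hg' _ (single_nonneg i)
  have hle (k : ι) :
      c * g.symm (EuclideanSpace.single i (1 : ℝ)) k ≤ EuclideanSpace.single j (1 : ℝ) k := by
    have := hg' (g (EuclideanSpace.single j (1 : ℝ)) - c • EuclideanSpace.single i (1 : ℝ))
      (fun l => by
        by_cases hl : l = i
        · subst hl
          simp [hc]
        · simpa [hl] using hnn l) k
    simpa using this
  set m := g.symm (EuclideanSpace.single i (1 : ℝ)) j with hm
  have hsymm : g.symm (EuclideanSpace.single i (1 : ℝ)) = m • EuclideanSpace.single j (1 : ℝ) := by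
    ext k
    by_cases hk : k = j
    · subst hk
      simp [hm]
    · have h := hle k
      simp only [PiLp.single_apply, hk, if_false] at h
      simpa [hk] using le_antisymm (nonpos_of_mul_nonpos_right h hi) (hnn' k)
  have hm0 : m ≠ 0 := by
    intro h
    rw [h, zero_smul] at hsymm
    exact single_ne i (g.symm.map_eq_zero_iff.1 hsymm)
  have hgi := congrArg g hsymm
  rw [g.apply_symm_apply, map_smul] at hgi
  refine ⟨i, m⁻¹, inv_pos.2 ((hnn' j).lt_of_ne' hm0), ?_⟩
  rw [hgi, inv_smul_smul₀ hm0]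

/-- A linear automorphism of `ℝ^{d+1}` preserving the open positive orthant is the
composition of a positive diagonal matrix and a permutation matrix. -/
theorem automorphism_of_orthant_is_diagonal_times_permutation {d : ℕ}
    (g : Euc (d + 1) ≃ₗ[ℝ] Euc (d + 1))
    (hg : g '' {v : Euc (d + 1) | ∀ i, 0 < v i} = {v : Euc (d + 1) | ∀ i, 0 < v i}) :
    ∃ (σ : Equiv.Perm (Fin (d + 1))) (lam : Fin (d + 1) → ℝ),
      (∀ i, 0 < lam i) ∧
      ∀ i, g (EuclideanSpace.single i (1 : ℝ)) =
        lam i • EuclideanSpace.single (σ i) (1 : ℝ) := by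
  have hpos (v : Euc (d + 1)) (hv : ∀ i, 0 < v i) : ∀ i, 0 < g v i :=
    hg.subset (mem_image_of_mem g hv)
  have hpos' (v : Euc (d + 1)) (hv : ∀ i, 0 < v i) : ∀ i, 0 < g.symm v i := by
    obtain ⟨w, hw, rfl⟩ := hg.superset hv
    simpa using hw
  choose σ lam hlam hσ using exists_single_eq_smul_single g
    (nonneg_of_forall_pos g.toLinearMap hpos) (nonneg_of_forall_pos g.symm.toLinearMap hpos')
  have hinj : Function.Injective σ := by
    intro i j hij
    have h : lam j • EuclideanSpace.single i (1 : ℝ) = lam i • EuclideanSpace.single j (1 : ℝ) := by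
      apply g.injective
      rw [map_smul, map_smul, hσ, hσ, hij, smul_comm]
    by_contra hne
    have := congrArg (fun v : Euc (d + 1) => v i) h
    simp [hne, (hlam j).ne'] at this
  exact ⟨Equiv.ofBijective σ (Finite.injective_iff_bijective.1 hinj), lam, hlam, hσ⟩
end
end

section
/- Assume d ≥ 3, Ω is irreducible, and the torsion-free group Γ divides Ω. Then every flat of Ω is isolated: for every flat F there is no sequence of flats of Ω, all distinct from F, converging to F. -/
open Set Filter Metric

noncomputable section

/-- A flat of `Ω` with prescribed vertices `v`. -/
def IsFlatWith {d : ℕ} (Ω : Set (Euc d)) (v : Fin d → Euc d) : Prop :=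
  AffineIndependent ℝ v ∧
  (∀ j, v j ∈ closure Ω \ Ω) ∧
  intrinsicInterior ℝ (convexHull ℝ (Set.range v)) ⊆ Ω ∧
  convexHull ℝ (Set.range v) \ intrinsicInterior ℝ (convexHull ℝ (Set.range v)) ⊆ closure Ω \ Ω

/-- A (codimension-one, properly embedded) flat of `Ω`. -/
def IsFlat {d : ℕ} (Ω : Set (Euc d)) (F : Set (Euc d)) : Prop :=
  ∃ v : Fin d → Euc d, IsFlatWith Ω v ∧ F = intrinsicInterior ℝ (convexHull ℝ (Set.range v))

/-- The cone over a subset of `ℝ^d`, inside `ℝ^d × ℝ ≅ ℝ^{d+1}`. -/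
def coneOver {d : ℕ} (S : Set (Euc d)) : Set (Euc d × ℝ) :=
  {p | ∃ t : ℝ, 0 < t ∧ ∃ x ∈ S, p = t • (x, (1 : ℝ))}

/-- Irreducibility of a properly convex domain: its cone admits no direct-sum
decomposition into convex cones. -/
def IsIrreducibleDomain {d : ℕ} (Ω : Set (Euc d)) : Prop :=
  ¬ ∃ (V₁ V₂ : Submodule ℝ (Euc d × ℝ)) (C₁ C₂ : Set (Euc d × ℝ)),
      V₁ ≠ ⊥ ∧ V₂ ≠ ⊥ ∧ V₁ ≠ ⊤ ∧ V₂ ≠ ⊤ ∧ IsCompl V₁ V₂ ∧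
      C₁ ⊆ (V₁ : Set (Euc d × ℝ)) ∧ C₂ ⊆ (V₂ : Set (Euc d × ℝ)) ∧
      Convex ℝ C₁ ∧ Convex ℝ C₂ ∧
      (∀ t : ℝ, 0 < t → ∀ c ∈ C₁, t • c ∈ C₁) ∧
      (∀ t : ℝ, 0 < t → ∀ c ∈ C₂, t • c ∈ C₂) ∧
      coneOver Ω = {p | ∃ c₁ ∈ C₁, ∃ c₂ ∈ C₂, p = c₁ + c₂}

/-- The homeomorphism of `Ω` induced by a linear automorphism of `ℝ^{d+1}`
preserving the cone over `Ω`. -/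
def projAct {d : ℕ} (g : (Euc d × ℝ) ≃ₗ[ℝ] (Euc d × ℝ)) (x : Euc d) : Euc d :=
  ((g (x, 1)).2)⁻¹ • (g (x, 1)).1

/-- `Γ` divides `Ω`: every element preserves the cone over `Ω`; the induced action on `Ω`
is free and properly discontinuous, and admits a compact set whose translates cover `Ω`. -/
def Divides {d : ℕ} (Ω : Set (Euc d))
    (Γ : Subgroup ((Euc d × ℝ) ≃ₗ[ℝ] (Euc d × ℝ))) : Prop :=
  (∀ γ ∈ Γ, (γ : (Euc d × ℝ) ≃ₗ[ℝ] (Euc d × ℝ)) '' coneOver Ω = coneOver Ω) ∧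
  (∀ γ ∈ Γ, γ ≠ 1 → ∀ x ∈ Ω, projAct γ x ≠ x) ∧
  (∀ K : Set (Euc d), K ⊆ Ω → IsCompact K →
    {γ : (Euc d × ℝ) ≃ₗ[ℝ] (Euc d × ℝ) | γ ∈ Γ ∧ (projAct γ '' K ∩ K).Nonempty}.Finite) ∧
  (∃ K : Set (Euc d), K ⊆ Ω ∧ IsCompact K ∧ (⋃ γ ∈ Γ, projAct γ '' K) = Ω)

/-- `Γ` is torsion-free. -/
def TorsionFreeSub {d : ℕ} (Γ : Subgroup ((Euc d × ℝ) ≃ₗ[ℝ] (Euc d × ℝ))) : Prop :=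
  ∀ γ ∈ Γ, ∀ n : ℕ, n ≠ 0 → γ ^ n = 1 → γ = 1

/-- Convergence of a sequence of flats: Hausdorff convergence of their closures. -/
def FlatsConverge {d : ℕ} (Fs : ℕ → Set (Euc d)) (F : Set (Euc d)) : Prop :=
  Tendsto (fun i => hausdorffDist (closure (Fs i)) (closure F)) atTop (nhds 0)

/-- A flat is isolated if no sequence of flats, all distinct from it, converges to it. -/
def IsIsolatedFlat {d : ℕ} (Ω F : Set (Euc d)) : Prop :=
  ¬ ∃ Fs : ℕ → Set (Euc d), (∀ i, IsFlat Ω (Fs i)) ∧ (∀ i, Fs i ≠ F) ∧ FlatsConverge Fs F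

/-- The union of all flats of `Ω`. -/
def flatsUnion {d : ℕ} (Ω : Set (Euc d)) : Set (Euc d) := ⋃₀ {F | IsFlat Ω F}

/-- A boundary flat: a flat contained in the closure of a connected component of the
complement of the union of all flats. -/
def IsBoundaryFlat {d : ℕ} (Ω F : Set (Euc d)) : Prop :=
  IsFlat Ω F ∧ ∃ x ∈ Ω \ flatsUnion Ω,
    F ⊆ closure (connectedComponentIn (Ω \ flatsUnion Ω) x)

/-- An open convex cone, strictly positive with respect to some functional, whose images under
linear isomorphisms onto `ι → ℝ` form a family satisfying Benzécri's compactness theorem, and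
which does not split along any coordinate decomposition. Isomorphisms are recorded by their
inverses `f : (ι → ℝ) ≃L[ℝ] V`, so that the corresponding cone is `f ⁻¹' C`. -/
structure IsBenzecriCone (ι : Type*) [Fintype ι] [DecidableEq ι] {V : Type*}
    [NormedAddCommGroup V] [NormedSpace ℝ V] (C : Set V) : Prop where
  isOpen : IsOpen C
  add_mem : ∀ {x y : V}, x ∈ C → y ∈ C → x + y ∈ C
  smul_mem : ∀ {t : ℝ} {x : V}, 0 < t → x ∈ C → t • x ∈ C
  pointed : ∃ φ : V →ₗ[ℝ] ℝ, ∀ y ∈ C, ‖y‖ ≤ φ y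
  exists_limit : ∀ f : ℕ → (ι → ℝ) ≃L[ℝ] V,
    (∃ U : Set (ι → ℝ), IsOpen U ∧ U.Nonempty ∧ ∀ n, ∀ y ∈ U, f n y ∈ C) →
    (∃ φ : (ι → ℝ) →ₗ[ℝ] ℝ, ∀ n y, f n y ∈ C → ∀ i, |y i| ≤ φ y) →
    ∃ (g : (ι → ℝ) ≃L[ℝ] V) (s : ℕ → ℕ), StrictMono s ∧
      (∀ y, g y ∈ C → ∀ᶠ n in atTop, f (s n) y ∈ C) ∧
      (∀ y, (∃ᶠ n in atTop, f (s n) y ∈ C) → g y ∈ closure C)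
  irreducible : ∀ (f : (ι → ℝ) ≃L[ℝ] V) (J : Finset ι), J.Nonempty → J ≠ Finset.univ →
    ∃ x y, f x ∈ C ∧ f y ∈ C ∧ f (J.piecewise x y) ∉ C

namespace IsBenzecriCone

section General

variable {ι : Type*} [Fintype ι] [DecidableEq ι] {V : Type*} [NormedAddCommGroup V]
  [NormedSpace ℝ V] {C : Set V}

lemma closure_add_mem (h : IsBenzecriCone ι C) {x y : V} (hx : x ∈ closure C) (hy : y ∈ C) :
    x + y ∈ C := by
  have hopen : IsOpen ((fun z => y + (x - z)) ⁻¹' C) := h.isOpen.preimage (by fun_prop)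
  obtain ⟨z, hz, hzC⟩ := mem_closure_iff.1 hx _ hopen (by simpa using hy)
  have := h.add_mem hzC hz
  rwa [show z + (y + (x - z)) = x + y by abel] at this

lemma smul_mem_closure (h : IsBenzecriCone ι C) {t : ℝ} (ht : 0 < t) {x : V}
    (hx : x ∈ closure C) : t • x ∈ closure C :=
  map_mem_closure (continuous_const_smul t) hx fun _ hy => h.smul_mem ht hy

lemma mem_closure_of_add_smul (x y : V)
    (hxy : ∀ ε : ℝ, 0 < ε → x + ε • y ∈ closure C) : x ∈ closure C := by
  have ht : Tendsto (fun ε : ℝ => x + ε • y) (nhdsWithin 0 (Ioi 0)) (nhds x) := by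
    have : Tendsto (fun ε : ℝ => x + ε • y) (nhds 0) (nhds (x + (0 : ℝ) • y)) :=
      (by fun_prop : Continuous fun ε : ℝ => x + ε • y).tendsto 0
    simpa using this.mono_left nhdsWithin_le_nhds
  exact isClosed_closure.mem_of_tendsto ht
    (eventually_nhdsWithin_of_forall fun ε hε => hxy ε hε)

lemma add_mem_closure (h : IsBenzecriCone ι C) {x y : V} (hx : x ∈ closure C)
    (hy : y ∈ closure C) : x + y ∈ closure C :=
  closure_closure (s := C) ▸ map_mem_closure (f := fun z => x + z) (by fun_prop) hy fun _ hz =>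
    subset_closure (h.closure_add_mem hx hz)

/-- Perturbing a point of an open set along a fixed direction. -/
lemma exists_sub_smul_mem (h : IsBenzecriCone ι C) (f : (ι → ℝ) ≃L[ℝ] V) {x : ι → ℝ}
    (y : ι → ℝ) (hx : f x ∈ C) : ∀ᶠ ε : ℝ in nhds 0, f (x - ε • y) ∈ C := by
  have hc : Continuous fun ε : ℝ => f (x - ε • y) := by fun_prop
  exact hc.continuousAt.eventually_mem (h.isOpen.mem_nhds (by simpa using hx))

/-- The cone contains the interior of its closure. -/
lemma mem_of_open_closure (h : IsBenzecriCone ι C) {z : V} (hz : z ∈ C) {U : Set V}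
    (hU : IsOpen U) (hUC : U ⊆ closure C) {x : V} (hx : x ∈ U) : x ∈ C := by
  have hc : Continuous fun ε : ℝ => x - ε • z := by fun_prop
  have h1 : ∀ᶠ ε : ℝ in nhds 0, x - ε • z ∈ U :=
    hc.continuousAt.eventually_mem (hU.mem_nhds (by simpa using hx))
  obtain ⟨ε, hε, hε0⟩ := ((h1.filter_mono nhdsWithin_le_nhds).and
    (eventually_mem_nhdsWithin (s := Ioi (0 : ℝ)))).exists
  have := h.closure_add_mem (hUC hε) (h.smul_mem hε0 hz)
  simpa using this

end General

/-- The diagonal automorphism of `ι → ℝ` with nonzero entries `a`. -/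
def diagEquiv {ι : Type*} [Fintype ι] (a : ι → ℝ) (ha : ∀ i, a i ≠ 0) :
    (ι → ℝ) ≃L[ℝ] (ι → ℝ) :=
  LinearEquiv.toContinuousLinearEquiv
    { toFun := fun y => a * y
      map_add' := fun x y => mul_add a x y
      map_smul' := fun t y => by simp
      invFun := fun y => a⁻¹ * y
      left_inv := fun y => by
        ext i
        simp [inv_mul_cancel_left₀ (ha i)]
      right_inv := fun y => by
        ext i
        simp [mul_inv_cancel_left₀ (ha i)] }

@[simp] lemma diagEquiv_apply {ι : Type*} [Fintype ι] (a : ι → ℝ) (ha : ∀ i, a i ≠ 0)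
    (y : ι → ℝ) : diagEquiv a ha y = a * y := rfl

section Split

variable {ι : Type*} [Fintype ι] [DecidableEq ι] {V : Type*} [NormedAddCommGroup V]
  [NormedSpace ℝ V] {C : Set V}

/-- The contraction factors `(1, n + 1)` along a coordinate splitting. -/
def splitScale (J : Finset ι) (n : ℕ) (i : ι) : ℝ := if i ∈ J then (n : ℝ) + 1 else 1

omit [Fintype ι] in
lemma splitScale_pos (J : Finset ι) (n : ℕ) (i : ι) : 0 < splitScale J n i := by
  unfold splitScale
  split_ifs <;> positivity

omit [Fintype ι] in
lemma splitScale_mul (J : Finset ι) (n : ℕ) (y : ι → ℝ) :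
    splitScale J n * y = J.piecewise (0 : ι → ℝ) y + ((n : ℝ) + 1) • J.piecewise y (0 : ι → ℝ) := by
  ext i
  by_cases hi : i ∈ J <;> simp [splitScale, hi]

/-- A functional controlling the coordinates, uniformly under the contractions. -/
lemma exists_uniform_functional (h : IsBenzecriCone ι C) (f : (ι → ℝ) ≃L[ℝ] V) (J : Finset ι)
    (hJ : J.Nonempty) (hJ' : J ≠ Finset.univ) (φ : (ι → ℝ) →ₗ[ℝ] ℝ)
    (hφ : ∀ y, f y ∈ C → ∀ i ∉ J, |y i| ≤ φ (J.piecewise (0 : ι → ℝ) y)) :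
    ∃ Φ : (ι → ℝ) →ₗ[ℝ] ℝ, ∀ (n : ℕ) y, f (splitScale J n * y) ∈ C → ∀ i, |y i| ≤ Φ y := by
  obtain ⟨ψ, hψ⟩ := h.pointed
  obtain ⟨N, hN0, hN⟩ : ∃ N : ℝ, 0 ≤ N ∧ ∀ y, ‖y‖ ≤ N * ‖f y‖ := by
    refine ⟨‖(f.symm : V →L[ℝ] ι → ℝ)‖, norm_nonneg _, fun y => ?_⟩
    simpa using (f.symm : V →L[ℝ] ι → ℝ).le_opNorm (f y)
  let B : ℝ := ∑ i, |ψ (f (Pi.single i 1))|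
  have hB0 : 0 ≤ B := Finset.sum_nonneg fun _ _ => abs_nonneg _
  have hBle : ∀ (z : ι → ℝ) (r : ℝ), (∀ i, |z i| ≤ r) → |ψ (f z)| ≤ B * r := by
    intro z r hz
    have hsum : ψ (f z) = ∑ i, z i * ψ (f (Pi.single i 1)) := by
      conv_lhs => rw [pi_eq_sum_univ' z]
      simp [map_sum]
    rw [hsum, Finset.sum_mul]
    refine (Finset.abs_sum_le_sum_abs _ _).trans (Finset.sum_le_sum fun i _ => ?_)
    rw [abs_mul, mul_comm]
    exact mul_le_mul_of_nonneg_left (hz i) (abs_nonneg _)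
  obtain ⟨i₁, hi₁⟩ : ∃ i, i ∉ J := by
    by_contra hcon
    push Not at hcon
    exact hJ' (Finset.eq_univ_iff_forall.2 hcon)
  obtain ⟨i₂, hi₂⟩ := hJ
  let P : (ι → ℝ) →ₗ[ℝ] (ι → ℝ) :=
    { toFun := fun y => J.piecewise (0 : ι → ℝ) y
      map_add' := fun x y => by ext i; by_cases hi : i ∈ J <;> simp [hi]
      map_smul' := fun t y => by ext i; by_cases hi : i ∈ J <;> simp [hi] }
  let Q : (ι → ℝ) →ₗ[ℝ] (ι → ℝ) :=
    { toFun := fun y => J.piecewise y (0 : ι → ℝ)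
      map_add' := fun x y => by ext i; by_cases hi : i ∈ J <;> simp [hi]
      map_smul' := fun t y => by ext i; by_cases hi : i ∈ J <;> simp [hi] }
  let ψf : (ι → ℝ) →ₗ[ℝ] ℝ := ψ ∘ₗ (f : (ι → ℝ) →ₗ[ℝ] V)
  refine ⟨(N * B + 1) • (φ ∘ₗ P) + N • (ψf ∘ₗ Q), fun n y hy => ?_⟩
  have hP : J.piecewise (0 : ι → ℝ) (splitScale J n * y) = J.piecewise (0 : ι → ℝ) y := by
    ext i; by_cases hi : i ∈ J <;> simp [hi, splitScale]
  have hPy : ∀ i ∉ J, |y i| ≤ φ (J.piecewise (0 : ι → ℝ) y) := by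
    intro i hi
    have := hφ _ hy i hi
    rw [hP] at this
    simpa [splitScale, hi] using this
  have hφ0 : 0 ≤ φ (J.piecewise (0 : ι → ℝ) y) := (abs_nonneg _).trans (hPy i₁ hi₁)
  have hPle : |ψ (f (J.piecewise (0 : ι → ℝ) y))| ≤ B * φ (J.piecewise (0 : ι → ℝ) y) := by
    refine hBle _ _ fun i => ?_
    by_cases hi : i ∈ J
    · simpa [hi] using hφ0
    · simpa [hi] using hPy i hi
  have hQ : ∀ i ∈ J, |y i| ≤ N * (B * φ (J.piecewise (0 : ι → ℝ) y)) +
      N * ψ (f (J.piecewise y (0 : ι → ℝ))) := by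
    intro i hi
    have h1 : ((n : ℝ) + 1) * |y i| ≤
        N * (ψ (f (J.piecewise (0 : ι → ℝ) y)) +
          ((n : ℝ) + 1) * ψ (f (J.piecewise y (0 : ι → ℝ)))) := by
      have h2 : ‖(splitScale J n * y) i‖ ≤ N * ψ (f (splitScale J n * y)) :=
        (norm_le_pi_norm _ i).trans ((hN _).trans (mul_le_mul_of_nonneg_left (hψ _ hy) hN0))
      rw [splitScale_mul] at h2
      simpa [hi, abs_mul, abs_of_nonneg (by positivity : (0 : ℝ) ≤ (n : ℝ) + 1)] using h2
    have h3 : ψ (f (J.piecewise (0 : ι → ℝ) y)) ≤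
        ((n : ℝ) + 1) * (B * φ (J.piecewise (0 : ι → ℝ) y)) := by
      have h4 := (le_abs_self _).trans hPle
      have h5 : 0 ≤ B * φ (J.piecewise (0 : ι → ℝ) y) := mul_nonneg hB0 hφ0
      nlinarith [(Nat.cast_nonneg n : (0 : ℝ) ≤ n)]
    have h4 : ((n : ℝ) + 1) * |y i| ≤ ((n : ℝ) + 1) *
        (N * (B * φ (J.piecewise (0 : ι → ℝ) y)) + N * ψ (f (J.piecewise y (0 : ι → ℝ)))) := by
      refine h1.trans ?_
      have := mul_le_mul_of_nonneg_left h3 hN0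
      linarith
    exact le_of_mul_le_mul_left h4 (by positivity)
  have hΦ : ((N * B + 1) • (φ ∘ₗ P) + N • (ψf ∘ₗ Q)) y =
      (N * (B * φ (J.piecewise (0 : ι → ℝ) y)) + N * ψ (f (J.piecewise y (0 : ι → ℝ)))) +
        φ (J.piecewise (0 : ι → ℝ) y) := by
    simp [P, Q, ψf]
    ring
  intro i
  rw [hΦ]
  by_cases hi : i ∈ J
  · linarith [hQ i hi]
  · linarith [hPy i hi, (abs_nonneg _).trans (hQ i₂ hi₂)]

/-- If the closed cone contains a relatively open subset of a coordinate subspace, then the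
projection along that subspace cannot be pointed. -/
theorem false_of_pointed_quotient (h : IsBenzecriCone ι C) (f : (ι → ℝ) ≃L[ℝ] V) (J : Finset ι)
    (hJ : J.Nonempty) (hJ' : J ≠ Finset.univ) (q : ι → ℝ) {δ : ℝ} (hδ : 0 < δ)
    (hq : ∀ z : ι → ℝ, (∀ i ∉ J, z i = 0) → (∀ i ∈ J, |z i - q i| < δ) → f z ∈ closure C)
    (φ : (ι → ℝ) →ₗ[ℝ] ℝ)
    (hφ : ∀ y, f y ∈ C → ∀ i ∉ J, |y i| ≤ φ (J.piecewise (0 : ι → ℝ) y)) : False := by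
  obtain ⟨y₀, -, hy₀, -, -⟩ := h.irreducible f J hJ hJ'
  let F : ℕ → (ι → ℝ) ≃L[ℝ] V := fun n =>
    (diagEquiv (splitScale J n) fun i => (splitScale_pos J n i).ne').trans f
  have hF : ∀ n y, F n y = f (splitScale J n * y) := fun n y => rfl
  have hU : ∃ U : Set (ι → ℝ), IsOpen U ∧ U.Nonempty ∧ ∀ n, ∀ y ∈ U, F n y ∈ C := by
    obtain ⟨M, hM0, hM⟩ : ∃ M : ℝ, 0 < M ∧ ∀ i, |y₀ i| + 1 ≤ M * δ := by
      refine ⟨(‖y₀‖ + 1) / δ, by positivity, fun i => ?_⟩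
      rw [div_mul_cancel₀ _ hδ.ne']
      have := norm_le_pi_norm y₀ i
      rw [Real.norm_eq_abs] at this
      linarith
    refine ⟨{y | f (J.piecewise y₀ y) ∈ C} ∩ {y | ∀ i, |y i - M * J.piecewise q y₀ i| < 1 ∨ i ∉ J},
      ?_, ⟨J.piecewise (M • q) y₀, ?_, ?_⟩, ?_⟩
    · refine IsOpen.inter ?_ ?_
      · have : Continuous fun y : ι → ℝ => J.piecewise y₀ y := by
          refine continuous_pi fun i => ?_
          by_cases hi : i ∈ J
          · simpa [hi] using continuous_const
          · simpa [hi] using continuous_apply i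
        exact h.isOpen.preimage (f.continuous.comp this)
      · rw [Set.ofPred_forall]
        refine isOpen_iInter_of_finite fun i => ?_
        by_cases hi : i ∈ J
        · simp only [hi, not_true, or_false]
          exact isOpen_lt (by fun_prop) continuous_const
        · simp [hi]
    · have : J.piecewise y₀ (J.piecewise (M • q) y₀) = y₀ := by
        ext i; by_cases hi : i ∈ J <;> simp [hi]
      simpa [this] using hy₀
    · intro i
      by_cases hi : i ∈ J <;> simp [hi]
    · rintro n y ⟨hy1, hy2⟩
      let z : ι → ℝ := J.piecewise (((n : ℝ) + 1) • y - y₀) 0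
      have hz : f z ∈ closure C := by
        have hr : (0 : ℝ) < ((n : ℝ) + 1) * M := by positivity
        have : f ((((n : ℝ) + 1) * M)⁻¹ • z) ∈ closure C := by
          refine hq _ (fun i hi => by simp [z, hi]) fun i hi => ?_
          have h1 := (hy2 i).resolve_right (by simpa using hi)
          rw [Finset.piecewise_eq_of_mem _ _ _ hi] at h1
          have h2 : (((((n : ℝ) + 1) * M)⁻¹ • z) i - q i) =
              (y i - M * q i - y₀ i / ((n : ℝ) + 1)) / M := by
            simp [z, hi]
            field_simp
            ring
          rw [h2, abs_div, abs_of_pos hM0, div_lt_iff₀ hM0, mul_comm δ]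
          have h3 : |y₀ i / ((n : ℝ) + 1)| ≤ |y₀ i| := by
            rw [abs_div, abs_of_pos (by positivity : (0 : ℝ) < (n : ℝ) + 1)]
            exact div_le_self (abs_nonneg _) (by linarith [(Nat.cast_nonneg n : (0 : ℝ) ≤ n)])
          linarith [abs_sub (y i - M * q i) (y₀ i / ((n : ℝ) + 1)), hM i]
        have h4 := h.smul_mem_closure hr this
        rwa [← map_smul, smul_inv_smul₀ hr.ne'] at h4
      have hsum : splitScale J n * y = z + J.piecewise y₀ y := by
        ext i; by_cases hi : i ∈ J <;> simp [hi, z, splitScale]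
      rw [hF, hsum, map_add]
      exact h.closure_add_mem hz hy1
  obtain ⟨g, s, hs, hg1, hg2⟩ := h.exists_limit F hU
    (h.exists_uniform_functional f J hJ hJ' φ hφ)
  -- the limit cone splits
  have key : ∀ x y, g x ∈ C → g y ∈ C → g (J.piecewise x y) ∈ closure C := by
    intro y x hy hx
    obtain ⟨n₀, hn₀⟩ := (hg1 x hx).exists
    have hev : ∀ᶠ n : ℕ in atTop,
        g (y - (((s n₀ : ℝ) + 1) / ((s n : ℝ) + 1)) • x) ∈ C := by
      have ht : Tendsto (fun n : ℕ => ((s n₀ : ℝ) + 1) / ((s n : ℝ) + 1)) atTop (nhds 0) :=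
        Tendsto.div_atTop tendsto_const_nhds (tendsto_atTop_add_const_right _ _
          (tendsto_natCast_atTop_atTop.comp hs.tendsto_atTop))
      exact ht.eventually (h.exists_sub_smul_mem g x hy)
    have hQcl : ∀ w, g w ∈ C → f (J.piecewise w (0 : ι → ℝ)) ∈ closure C := by
      intro w hw
      have ht : Tendsto (fun n : ℕ => f (((s n : ℝ) + 1)⁻¹ • (splitScale J (s n) * w))) atTop
          (nhds (f (J.piecewise w (0 : ι → ℝ)))) := by
        have h1 : Tendsto (fun n : ℕ => ((s n : ℝ) + 1)⁻¹) atTop (nhds 0) :=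
          tendsto_inv_atTop_zero.comp (tendsto_atTop_add_const_right _ _
            (tendsto_natCast_atTop_atTop.comp hs.tendsto_atTop))
        have h2 : ∀ n : ℕ, ((s n : ℝ) + 1)⁻¹ • (splitScale J (s n) * w) =
            ((s n : ℝ) + 1)⁻¹ • J.piecewise (0 : ι → ℝ) w + J.piecewise w (0 : ι → ℝ) := by
          intro n
          rw [splitScale_mul, smul_add, inv_smul_smul₀ (by positivity)]
        simp_rw [h2]
        have h3 := (h1.smul_const (J.piecewise (0 : ι → ℝ) w)).add_const (J.piecewise w (0 : ι → ℝ))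
        rw [zero_smul, zero_add] at h3
        exact (f.continuous.tendsto _).comp h3
      refine isClosed_closure.mem_of_tendsto ht ?_
      filter_upwards [hg1 w hw] with n hn
      rw [map_smul]
      exact subset_closure (h.smul_mem (by positivity) hn)
    refine hg2 _ (Eventually.frequently ?_)
    filter_upwards [hev] with n hn
    have h1 := h.smul_mem_closure (by positivity : (0 : ℝ) < (s n : ℝ) + 1) (hQcl _ hn)
    rw [← map_smul] at h1
    have h2 := h.closure_add_mem h1 hn₀
    rw [hF, ← map_add] at h2
    rw [hF]
    convert h2 using 2
    ext i
    have hne : (s n : ℝ) + 1 ≠ 0 := by positivity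
    by_cases hi : i ∈ J
    · simp [hi, splitScale]
      field_simp
      ring
    · simp [hi, splitScale]
  obtain ⟨x, y, hx, hy, hxy⟩ := h.irreducible g J hJ hJ'
  apply hxy
  -- perturb `x` and `y`
  have hpw : ∀ w : ι → ℝ, J.piecewise (w + x - J.piecewise x y) (w + y - J.piecewise x y) = w := by
    intro w
    ext i; by_cases hi : i ∈ J <;> simp [hi]
  have hUo : IsOpen {w : ι → ℝ | g (w + x - J.piecewise x y) ∈ C ∧
      g (w + y - J.piecewise x y) ∈ C} :=
    (h.isOpen.preimage (by fun_prop)).inter (h.isOpen.preimage (by fun_prop))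
  refine h.mem_of_open_closure hx (U := g.symm ⁻¹' {w : ι → ℝ | g (w + x - J.piecewise x y) ∈ C ∧
      g (w + y - J.piecewise x y) ∈ C}) (hUo.preimage g.symm.continuous) ?_ ?_
  · rintro v ⟨hv1, hv2⟩
    have := key _ _ hv1 hv2
    rwa [hpw, g.apply_symm_apply] at this
  · simp [hx, hy]

end Split

section Adapted

variable {κ : Type*} [Fintype κ] [DecidableEq κ] {V : Type*} [NormedAddCommGroup V]
  [NormedSpace ℝ V] {C : Set V}

/-- Coordinates adapted to a flat: the hyperplane `y none = 0` meets the cone in the open positive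
orthant, and the other coordinates are positive on the cone. -/
structure IsAdapted (C : Set V) (f : (Option κ → ℝ) ≃L[ℝ] V) : Prop where
  mem_of_pos : ∀ y : Option κ → ℝ, y none = 0 → (∀ k, 0 < y (some k)) → f y ∈ C
  pos : ∀ y, f y ∈ C → ∀ k, 0 < y (some k)

omit [DecidableEq κ] in
lemma IsAdapted.scale {f : (Option κ → ℝ) ≃L[ℝ] V} (hf : IsAdapted C f) (a : Option κ → ℝ)
    (ha : ∀ i, a i ≠ 0) (ha' : ∀ k, 0 < a (some k)) : IsAdapted C ((diagEquiv a ha).trans f) where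
  mem_of_pos y hy0 hy := hf.mem_of_pos _ (by simp [hy0]) fun k => by
    simpa using mul_pos (ha' k) (hy k)
  pos y hy k := (pos_iff_pos_of_mul_pos (hf.pos _ hy k)).1 (ha' k)

omit [Fintype κ] in
lemma IsAdapted.mem_closure {f : (Option κ → ℝ) ≃L[ℝ] V} (hf : IsAdapted C f)
    (y : Option κ → ℝ) (hy0 : y none = 0) (hy : ∀ k, 0 ≤ y (some k)) : f y ∈ closure C := by
  refine mem_closure_of_add_smul (f y) (f (Function.update (1 : Option κ → ℝ) none 0))
    fun ε hε => ?_
  rw [← map_smul, ← map_add]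
  exact subset_closure (hf.mem_of_pos _ (by simp [hy0]) fun k => by
    simpa using add_pos_of_nonneg_of_pos (hy k) hε)

omit [Fintype κ] [DecidableEq κ] in
lemma IsAdapted.nonneg {f : (Option κ → ℝ) ≃L[ℝ] V} (hf : IsAdapted C f) (y : Option κ → ℝ)
    (hy : f y ∈ closure C) (k : κ) : 0 ≤ y (some k) := by
  have hc : Continuous fun v : V => f.symm v (some k) :=
    (continuous_apply (some k)).comp f.symm.continuous
  have : (0 : ℝ) ≤ f.symm (f y) (some k) := by
    refine closure_minimal (t := {v : V | 0 ≤ f.symm v (some k)}) ?_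
      (isClosed_le continuous_const hc) hy
    intro v hv
    exact (hf.pos (f.symm v) (by simpa using hv) k).le
  simpa using this

/-- Moving towards the hyperplane and increasing the positive coordinates stays in the cone. -/
lemma mem_of_le_closure (h : IsBenzecriCone (Option κ) C) {f : (Option κ → ℝ) ≃L[ℝ] V}
    (hf : IsAdapted C f) {y y' : Option κ → ℝ} {θ : ℝ} (hy : f y ∈ closure C) (hθ : 0 ≤ θ)
    (hθ1 : θ < 1) (h0 : y' none = θ * y none) (hk : ∀ k, y (some k) ≤ y' (some k))
    (hk' : ∀ k, 0 < y' (some k)) : f y' ∈ C := by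
  have hw : f (y' - θ • y) ∈ C := hf.mem_of_pos _ (by simp [h0]) fun k => by
    have := mul_le_mul_of_nonneg_left (hk k) hθ
    have := mul_lt_mul_of_pos_right hθ1 (hk' k)
    simp only [Pi.sub_apply, Pi.smul_apply, smul_eq_mul]
    linarith
  rcases hθ.eq_or_lt with rfl | hθ0
  · simpa using hw
  · have := h.closure_add_mem (h.smul_mem_closure hθ0 hy) hw
    rw [← map_smul, ← map_add] at this
    simpa using this

lemma mem_of_le (h : IsBenzecriCone (Option κ) C) {f : (Option κ → ℝ) ≃L[ℝ] V}
    (hf : IsAdapted C f) {y y' : Option κ → ℝ} {θ : ℝ} (hy : f y ∈ C) (hθ : 0 ≤ θ)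
    (hθ1 : θ < 1) (h0 : y' none = θ * y none) (hk : ∀ k, y (some k) ≤ y' (some k)) : f y' ∈ C :=
  h.mem_of_le_closure hf (subset_closure hy) hθ hθ1 h0 hk fun k =>
    (hf.pos y hy k).trans_le (hk k)

/-- The boundary of the cone has no facet on a coordinate hyperplane. -/
lemma pos_of_mem_closure (h : IsBenzecriCone (Option κ) C) {f : (Option κ → ℝ) ≃L[ℝ] V}
    (hf : IsAdapted C f) {w : Option κ → ℝ} (hw : f w ∈ closure C) (hw0 : w none ≠ 0) (k : κ) :
    0 < w (some k) := by
  by_contra hcon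
  have hwk : w (some k) = 0 := le_antisymm (not_lt.1 hcon) (hf.nonneg w hw k)
  -- near `w + e`, all coefficients stay positive
  obtain ⟨δ, hδ, hδ'⟩ : ∃ δ : ℝ, 0 < δ ∧ ∀ z : Option κ → ℝ, z (some k) = 0 →
      (∀ i ∈ Finset.univ.erase (some k),
        |z i - (w + Function.update (1 : Option κ → ℝ) none 0) i| < δ) →
      0 < z none / w none ∧ ∀ m, m ≠ k → 0 ≤ (z - (z none / w none) • w) (some m) := by
    have hev : ∀ᶠ z in nhds (w + Function.update (1 : Option κ → ℝ) none 0 : Option κ → ℝ),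
        0 < z none / w none ∧ ∀ m, 0 < (z - (z none / w none) • w) (some m) := by
      refine Filter.Eventually.and ?_ (Filter.eventually_all.2 fun m => ?_)
      · have hc : Continuous fun z : Option κ → ℝ => z none / w none := by fun_prop
        refine hc.continuousAt.eventually_mem (IsOpen.mem_nhds isOpen_Ioi (mem_Ioi.2 ?_))
        simp [hw0]
      · have hc : Continuous fun z : Option κ → ℝ => (z - (z none / w none) • w) (some m) := by
          simp only [Pi.sub_apply, Pi.smul_apply, smul_eq_mul]
          fun_prop
        refine hc.continuousAt.eventually_mem (IsOpen.mem_nhds isOpen_Ioi (mem_Ioi.2 ?_))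
        simp [hw0]
    obtain ⟨δ, hδ, hball⟩ := Metric.eventually_nhds_iff.1 hev
    refine ⟨δ, hδ, fun z hzk hz => ?_⟩
    have hz' := @hball (Function.update z (some k) 1) ((dist_pi_lt_iff hδ).2 fun i => by
      by_cases hi : i = some k
      · subst hi
        simpa [hwk] using hδ
      · simpa [hi, Real.dist_eq] using hz i (by simp [hi]))
    simp only [Function.update_of_ne (show none ≠ some k by simp)] at hz'
    refine ⟨hz'.1, fun m hm => ?_⟩
    have := hz'.2 m
    simp only [Pi.sub_apply, Function.update_of_ne (show some m ≠ some k by simpa using hm)] at this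
    exact this.le
  refine h.false_of_pointed_quotient f (Finset.univ.erase (some k)) ⟨none, by simp⟩
    (fun hc => by simpa using (Finset.eq_univ_iff_forall.1 hc (some k)))
    (w + Function.update (1 : Option κ → ℝ) none 0) hδ ?_ (LinearMap.proj (some k)) ?_
  · intro z hz1 hz2
    have hzk : z (some k) = 0 := hz1 _ (by simp)
    obtain ⟨h1, h2⟩ := hδ' z hzk hz2
    have h3 : f (z - (z none / w none) • w) ∈ closure C := by
      refine hf.mem_closure _ (by simp [hw0]) fun m => ?_
      by_cases hm : m = k
      · subst hm
        simp [hzk, hwk]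
      · exact h2 m hm
    have h4 := h.add_mem_closure h3 (h.smul_mem_closure h1 hw)
    rw [← map_smul, ← map_add] at h4
    simpa using h4
  · intro y hy i hi
    obtain rfl : i = some k := by simpa using hi
    simpa using (abs_of_pos (hf.pos y hy k)).le

lemma exists_not_mem_update (h : IsBenzecriCone (Option κ) C) [Nonempty κ]
    {f : (Option κ → ℝ) ≃L[ℝ] V} (hf : IsAdapted C f) (y : Option κ → ℝ) (hy0 : y none ≠ 0) :
    ∃ m : ℕ, f (Function.update y none (2 ^ m * y none)) ∉ C := by
  by_contra hcon
  push Not at hcon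
  have hlim : f (Pi.single none (y none)) ∈ closure C := by
    have ht : Tendsto (fun m : ℕ => f (((2 : ℝ) ^ m)⁻¹ • Function.update y none 0 +
        Pi.single none (y none))) atTop (nhds (f (Pi.single none (y none)))) := by
      have h1 : Tendsto (fun m : ℕ => ((2 : ℝ) ^ m)⁻¹) atTop (nhds 0) :=
        tendsto_inv_atTop_zero.comp (tendsto_pow_atTop_atTop_of_one_lt one_lt_two)
      have h2 := (h1.smul_const (Function.update y none 0)).add_const
        (Pi.single none (y none) : Option κ → ℝ)
      rw [zero_smul, zero_add] at h2
      exact (f.continuous.tendsto _).comp h2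
    refine isClosed_closure.mem_of_tendsto ht (Eventually.of_forall fun m => ?_)
    have h3 := h.smul_mem (inv_pos.2 (pow_pos (two_pos (α := ℝ)) m)) (hcon m)
    rw [← map_smul] at h3
    convert subset_closure h3 using 2
    ext i
    cases i <;> simp
  have := h.pos_of_mem_closure hf hlim (by simpa using hy0) (Classical.arbitrary κ)
  simp at this

/-- A bound on the height of the cone from a point outside of it. -/
lemma abs_le_of_not_mem (h : IsBenzecriCone (Option κ) C) {f : (Option κ → ℝ) ≃L[ℝ] V}
    (hf : IsAdapted C f) {x y : Option κ → ℝ} {b μ : ℝ} (hb : f (Function.update x none b) ∉ C)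
    (hy : f y ∈ C) (hμ : 0 < μ) (hle : ∀ k, y (some k) ≤ μ * x (some k))
    (hsign : 0 ≤ b * y none) : |y none| ≤ |b| * μ := by
  by_contra hlt
  push Not at hlt
  apply hb
  have hy0 : 0 < |y none| := lt_of_le_of_lt (by positivity) hlt
  have hy0' : y none ≠ 0 := abs_pos.1 hy0
  have hmem : f (μ • Function.update x none b) ∈ C := by
    refine h.mem_of_le hf hy (θ := |b| * μ / |y none|) (by positivity)
      ((div_lt_one hy0).2 hlt) ?_ (by simpa using hle)
    simp only [Pi.smul_apply, Function.update_self, smul_eq_mul]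
    rw [div_mul_eq_mul_div, eq_div_iff hy0.ne']
    have : b * |y none| = |b| * y none := by
      rcases lt_or_gt_of_ne hy0' with hneg | hpos
      · rw [abs_of_neg hneg, abs_of_nonpos (by nlinarith)]; ring
      · rw [abs_of_pos hpos, abs_of_nonneg (by nlinarith)]
    linear_combination μ * this
  have := h.smul_mem (inv_pos.2 hμ) hmem
  rwa [← map_smul, inv_smul_smul₀ hμ.ne'] at this

/-- Limits of adapted coordinate systems, normalised at the all-ones vector. -/
lemma exists_adapted_limit (h : IsBenzecriCone (Option κ) C) [Nonempty κ]
    (f : ℕ → (Option κ → ℝ) ≃L[ℝ] V) (hf : ∀ n, IsAdapted C (f n)) (h1 : ∀ n, f n 1 ∈ C) {b : ℝ}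
    (hb : 0 < b) (hb1 : ∀ n, f n (Function.update (1 : Option κ → ℝ) none b) ∉ C)
    (hb2 : ∀ n, f n (Function.update (1 : Option κ → ℝ) none (-b)) ∉ C) :
    ∃ (g : (Option κ → ℝ) ≃L[ℝ] V) (s : ℕ → ℕ), StrictMono s ∧
      (∀ y, g y ∈ C → ∀ᶠ n in atTop, f (s n) y ∈ C) ∧
      (∀ y : Option κ → ℝ, y none = 0 → (∀ k, 0 ≤ y (some k)) → g y ∈ closure C) := by
  have hsum : ∀ n y, f n y ∈ C → ∀ k, y (some k) ≤ ∑ k, y (some k) := fun n y hy k =>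
    Finset.single_le_sum (f := fun k => y (some k)) (fun i _ => ((hf n).pos y hy i).le)
      (Finset.mem_univ k)
  have hsum0 : ∀ n y, f n y ∈ C → 0 < ∑ k, y (some k) := fun n y hy =>
    Finset.sum_pos (fun i _ => (hf n).pos y hy i) Finset.univ_nonempty
  have hb0 : ∀ n y, f n y ∈ C → |y none| ≤ b * ∑ k, y (some k) := by
    intro n y hy
    rcases le_total 0 (y none) with h0 | h0
    · have := h.abs_le_of_not_mem (hf n) (hb1 n) hy (hsum0 n y hy) (by simpa using hsum n y hy)
        (mul_nonneg hb.le h0)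
      rwa [abs_of_pos hb] at this
    · have := h.abs_le_of_not_mem (hf n) (hb2 n) hy (hsum0 n y hy) (by simpa using hsum n y hy)
        (by nlinarith)
      rwa [abs_neg, abs_of_pos hb] at this
  have hU : ∃ U : Set (Option κ → ℝ), IsOpen U ∧ U.Nonempty ∧ ∀ n, ∀ y ∈ U, f n y ∈ C := by
    refine ⟨{y | 0 < y none ∧ ∀ k, y none < y (some k)}, ?_,
      ⟨fun i => i.elim 1 fun _ => 2, by simp⟩, ?_⟩
    · refine IsOpen.inter (isOpen_lt continuous_const (continuous_apply none)) ?_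
      have : ∀ k : κ, IsOpen {y : Option κ → ℝ | y none < y (some k)} := fun k =>
        isOpen_lt (continuous_apply none) (continuous_apply (some k))
      have hopen := isOpen_iInter_of_finite this
      rwa [← Set.ofPred_forall] at hopen
    · rintro n y ⟨hy0, hy⟩
      have h2 := h.add_mem (h.smul_mem hy0 (h1 n)) ((hf n).mem_of_pos (y - y none • 1)
        (by simp) fun k => by simpa using hy k)
      rw [← map_smul, ← map_add] at h2
      simpa using h2
  have hφ : ∃ φ : (Option κ → ℝ) →ₗ[ℝ] ℝ, ∀ n y, f n y ∈ C → ∀ i, |y i| ≤ φ y := by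
    refine ⟨(b + 1) • ∑ k, LinearMap.proj (some k), ?_⟩
    intro n y hy i
    have hval : ((b + 1) • ∑ k, LinearMap.proj (some k) : (Option κ → ℝ) →ₗ[ℝ] ℝ) y =
        b * ∑ k, y (some k) + ∑ k, y (some k) := by
      simp; ring
    rw [hval]
    have h3 := hsum0 n y hy
    rcases i with _ | k
    · linarith [hb0 n y hy]
    · rw [abs_of_pos ((hf n).pos y hy k)]
      linarith [hsum n y hy k, mul_pos hb h3]
  obtain ⟨g, s, hs, hg1, hg2⟩ := h.exists_limit f hU hφ
  refine ⟨g, s, hs, hg1, fun y hy0 hy => ?_⟩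
  refine mem_closure_of_add_smul (g y) (g (Function.update (1 : Option κ → ℝ) none 0))
    fun ε hε => ?_
  rw [← map_smul, ← map_add]
  refine hg2 _ (Frequently.of_forall fun n => (hf _).mem_of_pos _ (by simp [hy0]) fun k => ?_)
  simpa using add_pos_of_nonneg_of_pos (hy k) hε

/-- The two sides of the cone have comparable heights over the flat. -/
lemma exists_comparable (h : IsBenzecriCone (Option κ) C) [Nonempty κ]
    {f : (Option κ → ℝ) ≃L[ℝ] V} (hf : IsAdapted C f) :
    ∃ M : ℝ, 1 ≤ M ∧ ∀ y, f y ∈ C → f (Function.update y none (-(y none) / M)) ∈ C := by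
  by_contra hcon
  push Not at hcon
  have hseq : ∀ n : ℕ, ∃ y : Option κ → ℝ, y none ≠ 0 ∧ f y ∈ C ∧
      f (Function.update y none (2 * y none)) ∉ C ∧
      f (Function.update y none (-(2 / ((n : ℝ) + 1)) * y none)) ∉ C := by
    intro n
    obtain ⟨y, hy, hy'⟩ := hcon ((n : ℝ) + 1) (by simp)
    have hy0 : y none ≠ 0 := by
      intro h0
      apply hy'
      rwa [show -(y none) / ((n : ℝ) + 1) = y none by simp [h0], Function.update_eq_self]
    have hex := h.exists_not_mem_update hf y hy0
    classical
    have hm := Nat.find_spec hex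
    have hm0 : Nat.find hex ≠ 0 := by
      intro h0
      rw [h0] at hm
      simp [hy] at hm
    obtain ⟨m, hm'⟩ := Nat.exists_eq_succ_of_ne_zero hm0
    rw [hm'] at hm
    have hmin : f (Function.update y none (2 ^ m * y none)) ∈ C := by
      have := Nat.find_min hex (m := m) (by omega)
      simpa using this
    refine ⟨Function.update y none (2 ^ m * y none), by simp [hy0], hmin, ?_, fun hmem => hy' ?_⟩
    · convert hm using 3
      simp [pow_succ]
      ring_nf
    · refine h.mem_of_le hf hmem (θ := (2 * 2 ^ m)⁻¹) (by positivity) ?_ ?_ (by simp)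
      · apply inv_lt_one_of_one_lt₀
        linarith [one_le_pow₀ (one_le_two (α := ℝ)) (n := m)]
      · simp
        field_simp
  choose y hy0 hy hy1 hy2 using hseq
  have hyne : ∀ n i, y n i ≠ 0 := by
    intro n i
    rcases i with _ | k
    · exact hy0 n
    · exact (hf.pos _ (hy n) k).ne'
  let F : ℕ → (Option κ → ℝ) ≃L[ℝ] V := fun n => (diagEquiv (y n) (hyne n)).trans f
  have hFa : ∀ n, IsAdapted C (F n) := fun n => hf.scale _ _ (hf.pos _ (hy n))
  have hF : ∀ n (b : ℝ), F n (Function.update (1 : Option κ → ℝ) none b) =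
      f (Function.update (y n) none (b * y n none)) := by
    intro n b
    change f (y n * Function.update (1 : Option κ → ℝ) none b) = _
    congr 1
    ext i
    cases i <;> simp [mul_comm]
  have hF2 : ∀ n : ℕ, F n (Function.update (1 : Option κ → ℝ) none (-(2 / ((n : ℝ) + 1)))) ∉ C := by
    intro n
    rw [hF]
    exact hy2 n
  obtain ⟨g, s, hs, hg1, hg2⟩ := h.exists_adapted_limit F hFa (fun n => by
      change f (y n * 1) ∈ C
      simpa using hy n) (b := 4) (by norm_num)
    (fun n hmem => by
      rw [hF] at hmem
      exact hy1 n (h.mem_of_le hf hmem (θ := 1 / 2) (by norm_num) (by norm_num)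
        (by simp; ring) (by simp)))
    (fun n hmem => by
      rw [hF] at hmem
      have hn : (0 : ℝ) < (n : ℝ) + 1 := by positivity
      refine hy2 n (h.mem_of_le hf hmem (θ := 1 / (2 * ((n : ℝ) + 1))) (by positivity) ?_ ?_
        (by simp))
      · rw [div_lt_one (by positivity)]
        linarith [(Nat.cast_nonneg n : (0 : ℝ) ≤ n)]
      · simp
        field_simp
        ring)
  -- the limit lies on one side of the hyperplane
  have hside : ∀ x, g x ∈ C → 0 ≤ x none := by
    intro x hx
    by_contra hneg
    push Not at hneg
    have hev := hg1 x hx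
    have hbound : ∀ᶠ n in atTop, |x none| ≤ 2 / ((s n : ℝ) + 1) * ∑ k, x (some k) := by
      filter_upwards [hev] with n hn
      have hpos := (hFa (s n)).pos x hn
      have h3 := h.abs_le_of_not_mem (hFa (s n)) (hF2 (s n)) hn
        (Finset.sum_pos (fun i _ => hpos i) Finset.univ_nonempty)
        (by
          intro k
          simpa using Finset.single_le_sum (f := fun k => x (some k)) (fun i _ => (hpos i).le)
            (Finset.mem_univ k))
        (by
          have : (0 : ℝ) ≤ 2 / ((s n : ℝ) + 1) := by positivity
          nlinarith)
      rwa [abs_neg, abs_of_nonneg (by positivity : (0 : ℝ) ≤ 2 / ((s n : ℝ) + 1))] at h3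
    have ht : Tendsto (fun n : ℕ => 2 / ((s n : ℝ) + 1) * ∑ k, x (some k)) atTop (nhds 0) := by
      have : Tendsto (fun n : ℕ => 2 / ((s n : ℝ) + 1)) atTop (nhds 0) :=
        Tendsto.div_atTop tendsto_const_nhds (tendsto_atTop_add_const_right _ _
          (tendsto_natCast_atTop_atTop.comp hs.tendsto_atTop))
      simpa using this.mul_const (∑ k, x (some k))
    have := ge_of_tendsto ht hbound
    exact hneg.ne (abs_nonpos_iff.1 this)
  refine h.false_of_pointed_quotient g (Finset.univ.erase none)
    ⟨some (Classical.arbitrary κ), by simp⟩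
    (fun hc => by simpa using (Finset.eq_univ_iff_forall.1 hc none)) 1 one_pos ?_
    (LinearMap.proj none) ?_
  · intro z hz1 hz2
    refine hg2 z (hz1 _ (by simp)) fun k => ?_
    have := abs_lt.1 (hz2 (some k) (by simp))
    simp at this
    linarith
  · intro x hx i hi
    obtain rfl : i = none := by simpa using hi
    simpa using (abs_of_nonneg (hside x hx)).le

end Adapted

section Raise

variable {κ : Type*} [Fintype κ] [DecidableEq κ] {V : Type*} [NormedAddCommGroup V]
  [NormedSpace ℝ V] {C : Set V}

/-- Stretching one coordinate by a definite factor allows to raise the height fourfold. -/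
lemma exists_raise_coord (h : IsBenzecriCone (Option κ) C) [Nontrivial κ]
    {f : (Option κ → ℝ) ≃L[ℝ] V} (hf : IsAdapted C f) (j : κ) :
    ∃ T : ℝ, 0 < T ∧ ∀ y, f y ∈ C → 0 < y none →
      f (Function.update (Function.update y (some j) ((1 + T) * y (some j))) none
        (4 * y none)) ∈ C := by
  obtain ⟨M, hM1, hM⟩ := h.exists_comparable hf
  have hM0 : 0 < M := by linarith
  by_contra hcon
  push Not at hcon
  have hseq := fun n : ℕ => hcon ((n : ℝ) + 1) (by positivity)
  choose y hy hy0 hy1 using hseq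
  have hyne : ∀ n i, y n i ≠ 0 := by
    intro n i
    rcases i with _ | k
    · exact (hy0 n).ne'
    · exact (hf.pos _ (hy n) k).ne'
  let F : ℕ → (Option κ → ℝ) ≃L[ℝ] V := fun n => (diagEquiv (y n) (hyne n)).trans f
  have hFa : ∀ n, IsAdapted C (F n) := fun n => hf.scale _ _ (hf.pos _ (hy n))
  have hFM : ∀ n x, F n x ∈ C → F n (Function.update x none (-(x none) / M)) ∈ C := by
    intro n x hx
    have := hM _ hx
    change f (y n * Function.update x none (-(x none) / M)) ∈ C
    convert this using 2
    ext i
    cases i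
    · simp
      ring
    · simp
  have hF1 : ∀ n : ℕ, F n (Function.update (Function.update (1 : Option κ → ℝ) (some j)
      (1 + ((n : ℝ) + 1))) none 4) ∉ C := by
    intro n
    change f (y n * _) ∉ C
    convert hy1 n using 3
    ext i
    rcases i with _ | k
    · simp [mul_comm]
    · by_cases hk : k = j
      · subst hk
        simp [mul_comm]
      · simp [hk]
  have hF8 : ∀ n, F n (Function.update (1 : Option κ → ℝ) none 8) ∉ C := by
    intro n hmem
    refine hF1 n (h.mem_of_le (hFa n) hmem (θ := 1 / 2) (by norm_num) (by norm_num)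
      (by simp; norm_num) fun k => ?_)
    by_cases hk : k = j
    · subst hk
      simp
      positivity
    · simp [hk]
  obtain ⟨g, s, hs, hg1, hg2⟩ := h.exists_adapted_limit F hFa (fun n => by
      change f (y n * 1) ∈ C
      simpa using hy n) (b := 16 * M) (by positivity)
    (fun n hmem => hF8 n (h.mem_of_le (hFa n) hmem (θ := 1 / (2 * M)) (by positivity)
      ((div_lt_one (by positivity)).2 (by linarith)) (by simp; field_simp; norm_num) (by simp)))
    (fun n hmem => hF8 n (h.mem_of_le (hFa n) (hFM n _ hmem) (θ := 1 / 2) (by norm_num)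
      (by norm_num) (by simp; field_simp; norm_num) (by simp)))
  obtain ⟨j', hj'⟩ := exists_ne j
  have hbound : ∀ x, g x ∈ C → (∀ k, 0 < x (some k)) ∧
      |x none| ≤ 4 * M * ∑ k ∈ Finset.univ.erase j, x (some k) := by
    intro x hx
    have hev := hg1 x hx
    obtain ⟨n₀, hn₀⟩ := hev.exists
    have hpos := (hFa _).pos x hn₀
    set μ := ∑ k ∈ Finset.univ.erase j, x (some k) with hμ
    have hμ0 : 0 < μ := Finset.sum_pos (fun k _ => hpos k) ⟨j', by simp [hj']⟩
    refine ⟨hpos, ?_⟩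
    have hT : Tendsto (fun n : ℕ => (s n : ℝ)) atTop atTop :=
      tendsto_natCast_atTop_atTop.comp hs.tendsto_atTop
    obtain ⟨n, hn, hTn⟩ := (hev.and (hT.eventually_ge_atTop (x (some j) / μ))).exists
    have hle : ∀ k, x (some k) ≤ μ * Function.update (1 : Option κ → ℝ) (some j)
        (1 + ((s n : ℝ) + 1)) (some k) := by
      intro k
      by_cases hk : k = j
      · subst hk
        rw [div_le_iff₀ hμ0] at hTn
        simp only [Function.update_self]
        nlinarith
      · have := Finset.single_le_sum (f := fun k => x (some k))
          (fun i _ => (hpos i).le) (show k ∈ Finset.univ.erase j by simp [hk])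
        simp only [hk, ne_eq, Option.some.injEq, not_false_eq_true, Function.update_of_ne,
          Pi.one_apply, mul_one]
        exact this
    rcases le_total 0 (x none) with h0 | h0
    · have := h.abs_le_of_not_mem (hFa (s n)) (hF1 (s n)) hn hμ0 hle (by positivity)
      rw [abs_of_pos (four_pos (α := ℝ))] at this
      nlinarith
    · have hxn : 0 ≤ -(x none) / M := div_nonneg (by linarith) hM0.le
      have := h.abs_le_of_not_mem (hFa (s n)) (hF1 (s n)) (hFM _ _ hn) hμ0 (by simpa using hle)
        (by simpa using hxn)
      rw [abs_of_pos (four_pos (α := ℝ)), Function.update_self, abs_of_nonneg hxn,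
        div_le_iff₀ hM0] at this
      rw [abs_of_nonpos h0]
      linarith
  refine h.false_of_pointed_quotient g {some j} (by simp)
    (fun hc => by simpa using (Finset.eq_univ_iff_forall.1 hc none))
    (Pi.single (some j) 1) one_pos ?_
    ((4 * M + 1) • ∑ k ∈ Finset.univ.erase j, LinearMap.proj (some k)) ?_
  · intro z hz1 hz2
    refine hg2 z (hz1 _ (by simp)) fun k => ?_
    by_cases hk : k = j
    · subst hk
      have := abs_lt.1 (hz2 (some k) (by simp))
      simp at this
      linarith
    · exact (hz1 (some k) (by simp [hk])).ge
  · intro x hx i hi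
    obtain ⟨hpos, hx0⟩ := hbound x hx
    have hval : ((4 * M + 1) • ∑ k ∈ Finset.univ.erase j, LinearMap.proj (some k) :
        (Option κ → ℝ) →ₗ[ℝ] ℝ) (Finset.piecewise {some j} (0 : Option κ → ℝ) x) =
        (4 * M + 1) * ∑ k ∈ Finset.univ.erase j, x (some k) := by
      simp only [LinearMap.smul_apply, LinearMap.sum_apply, LinearMap.proj_apply, smul_eq_mul]
      congr 1
      refine Finset.sum_congr rfl fun k hk => ?_
      simp [Finset.ne_of_mem_erase hk]
    rw [hval]
    have hμ0 : 0 < ∑ k ∈ Finset.univ.erase j, x (some k) :=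
      Finset.sum_pos (fun k _ => hpos k) ⟨j', by simp [hj']⟩
    rcases i with _ | k
    · linarith
    · have hk : k ≠ j := by simpa using hi
      rw [abs_of_pos (hpos k)]
      have := Finset.single_le_sum (f := fun k => x (some k))
          (fun i _ => (hpos i).le) (show k ∈ Finset.univ.erase j by simp [hk])
      nlinarith [mul_pos hM0 hμ0]

/-- Uniform version of `exists_raise_coord`, on the closure of the cone. -/
lemma exists_raise (h : IsBenzecriCone (Option κ) C) [Nontrivial κ]
    {f : (Option κ → ℝ) ≃L[ℝ] V} (hf : IsAdapted C f) :
    ∃ T : ℝ, 0 < T ∧ ∀ j z, f z ∈ closure C → 0 < z none →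
      f (Function.update (Function.update z (some j) ((1 + T) * z (some j))) none
        (3 * z none)) ∈ closure C := by
  choose T hT0 hT using h.exists_raise_coord hf
  refine ⟨∑ j, T j, Finset.sum_pos (fun j _ => hT0 j) Finset.univ_nonempty, fun j z hz hz0 => ?_⟩
  have key : ∀ y, f y ∈ C → 0 < y none →
      f (Function.update (Function.update y (some j) ((1 + ∑ j, T j) * y (some j))) none
        (3 * y none)) ∈ C := by
    intro y hy hy0
    refine h.mem_of_le hf (hT j y hy hy0) (θ := 3 / 4) (by norm_num) (by norm_num)
      (by simp; ring) fun k => ?_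
    by_cases hk : k = j
    · subst hk
      have hle := Finset.single_le_sum (f := T) (fun i _ => (hT0 i).le) (Finset.mem_univ k)
      simpa using mul_le_mul_of_nonneg_right (add_le_add_right hle 1) (hf.pos y hy k).le
    · simp [hk]
  let G : V → V := fun v => f (Function.update (Function.update (f.symm v) (some j)
    ((1 + ∑ j, T j) * f.symm v (some j))) none (3 * f.symm v none))
  have hG : Continuous G := by
    have hc : ∀ i, Continuous fun v => f.symm v i := fun i =>
      (continuous_apply i).comp f.symm.continuous
    exact f.continuous.comp (((f.symm.continuous).update _ (continuous_const.mul (hc _))).update _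
      (continuous_const.mul (hc _)))
  have hO : IsOpen {v : V | 0 < f.symm v none} :=
    isOpen_lt continuous_const ((continuous_apply none).comp f.symm.continuous)
  have hz' : f z ∈ closure (C ∩ {v : V | 0 < f.symm v none}) :=
    hO.closure_inter ⟨hz, by simpa using hz0⟩
  have hmaps : ∀ v ∈ C ∩ {v : V | 0 < f.symm v none}, G v ∈ C := fun v hv =>
    key (f.symm v) (by simpa using hv.1) hv.2
  simpa [G] using map_mem_closure hG hz' hmaps

end Raise

section Separation

variable {κ : Type*} [Fintype κ] [DecidableEq κ] {V : Type*} [NormedAddCommGroup V]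
  [NormedSpace ℝ V] {C : Set V}

lemma add_smul_mem_of_raise (h : IsBenzecriCone (Option κ) C) {f : (Option κ → ℝ) ≃L[ℝ] V}
    (hf : IsAdapted C f) {T : ℝ} (hT : 0 < T) {j : κ}
    (hraise : ∀ z, f z ∈ closure C → 0 < z none →
      f (Function.update (Function.update z (some j) ((1 + T) * z (some j))) none
        (3 * z none)) ∈ closure C)
    {w w' : Option κ → ℝ} (hw : f w ∈ closure C) (hw' : f w' ∈ closure C) (h0 : 0 < w none)
    (h0' : 0 ≤ w' none) {s : ℝ} (hs : 0 < s) (hj : w (some j) ≤ s * w' (some j))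
    (hs0 : 2 * T * s * w' none ≤ w none) : f (w + ((1 + 2 * T) * s) • w') ∈ C := by
  have hcomb : ∀ t : ℝ, 0 < t → f (w + t • w') ∈ closure C := fun t ht => by
    have := h.add_mem_closure hw (h.smul_mem_closure ht hw')
    rwa [← map_smul, ← map_add] at this
  have hz0 : 0 < (w + s • w') none := by
    simpa using add_pos_of_pos_of_nonneg h0 (mul_nonneg hs.le h0')
  have hT' : 0 < (1 + 2 * T) * s := by positivity
  have hz0' : 0 < (w + ((1 + 2 * T) * s) • w') none := by
    simpa using add_pos_of_pos_of_nonneg h0 (mul_nonneg hT'.le h0')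
  refine h.mem_of_le_closure hf (hraise _ (hcomb s hs) hz0)
    (θ := (w + ((1 + 2 * T) * s) • w') none / (3 * (w + s • w') none)) (by positivity)
    ((div_lt_one (by positivity)).2 ?_) ?_ (fun k => ?_)
    (fun k => h.pos_of_mem_closure hf (hcomb _ hT') hz0'.ne' k)
  · simp only [Pi.add_apply, Pi.smul_apply, smul_eq_mul]
    nlinarith [mul_nonneg hs.le h0']
  · rw [Function.update_self, div_mul_cancel₀ _ (by positivity)]
  · by_cases hk : k = j
    · subst hk
      simp
      nlinarith
    · have := hf.nonneg w' hw' k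
      simp [hk]
      nlinarith [mul_nonneg hT.le (mul_nonneg hs.le this)]

lemma exists_separation_aux (h : IsBenzecriCone (Option κ) C) [Nontrivial κ]
    {f : (Option κ → ℝ) ≃L[ℝ] V} (hf : IsAdapted C f) :
    ∃ η : ℝ, 0 < η ∧ ∀ (i j : κ) (w w' : Option κ → ℝ), f w ∈ closure C → f w' ∈ closure C →
      (∀ s : ℝ, 0 < s → f (w + s • w') ∉ C) → 1 / 2 ≤ w (some i) → 1 / 2 ≤ w' (some j) →
      w (some j) ≤ η → w' (some i) ≤ η → 0 < w none → w' none < 0 := by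
  obtain ⟨T, hT, hraise⟩ := h.exists_raise hf
  refine ⟨1 / (8 * (T + 1)), by positivity, fun i j w w' hw hw' hnot hi hj hη hη' h0 => ?_⟩
  by_contra h0'
  push Not at h0'
  rcases h0'.eq_or_lt with h00 | h00
  · have hwj := hf.nonneg w hw j
    have hj0 : 0 < w' (some j) := by linarith
    have hs : 0 < w (some j) / w' (some j) + 1 := by positivity
    refine hnot _ (by positivity)
        (h.add_smul_mem_of_raise hf hT (hraise j) hw hw' h0 h0' hs ?_ ?_)
    · rw [add_mul, div_mul_cancel₀ _ hj0.ne']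
      linarith
    · rw [← h00]
      linarith
  · have h1 : w none * w' (some j) < 2 * T * w' none * w (some j) := by
      by_contra hcon
      push Not at hcon
      have hs : 0 < w none / (2 * T * w' none) := by positivity
      refine hnot _ (by positivity)
        (h.add_smul_mem_of_raise hf hT (hraise j) hw hw' h0 h0' hs ?_ ?_)
      · rw [div_mul_eq_mul_div, le_div_iff₀ (by positivity)]
        linarith
      · field_simp
        rfl
    have h2 : w' none * w (some i) < 2 * T * w none * w' (some i) := by
      by_contra hcon
      push Not at hcon
      have hs : 0 < w' none / (2 * T * w none) := by positivity
      have hmem := h.add_smul_mem_of_raise hf hT (hraise i) hw' hw h00 h0.le hs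
        (by rw [div_mul_eq_mul_div, le_div_iff₀ (by positivity)]; linarith)
        (by field_simp; rfl)
      have hs' : 0 < (1 + 2 * T) * (w' none / (2 * T * w none)) := by positivity
      refine hnot _ (inv_pos.2 hs') ?_
      have := h.smul_mem (inv_pos.2 hs') hmem
      rwa [← map_smul, smul_add, inv_smul_smul₀ hs'.ne', add_comm] at this
    have hη1 : T * (1 / (8 * (T + 1))) < 1 / 8 := by
      rw [mul_one_div, div_lt_div_iff₀ (by positivity) (by positivity)]
      linarith
    have h3 : 2 * T * w' none * w (some j) ≤ 1 / 4 * w' none := by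
      nlinarith [mul_le_mul_of_nonneg_left hη (mul_pos hT h00).le]
    have h4 : 2 * T * w none * w' (some i) ≤ 1 / 4 * w none := by
      nlinarith [mul_le_mul_of_nonneg_left hη' (mul_pos hT h0).le]
    nlinarith

/-- Two points of the boundary close to distinct vertices of the flat, and spanning a segment
in the boundary, lie on opposite sides of the flat. -/
lemma exists_separation (h : IsBenzecriCone (Option κ) C) [Nontrivial κ]
    {f : (Option κ → ℝ) ≃L[ℝ] V} (hf : IsAdapted C f) :
    ∃ η : ℝ, 0 < η ∧ ∀ (i j : κ) (w w' : Option κ → ℝ), f w ∈ closure C → f w' ∈ closure C →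
      (∀ s : ℝ, 0 < s → f (w + s • w') ∉ C) → 1 / 2 ≤ w (some i) → 1 / 2 ≤ w' (some j) →
      w (some j) ≤ η → w' (some i) ≤ η →
      (0 < w none → w' none < 0) ∧ (w none < 0 → 0 < w' none) := by
  let a : Option κ → ℝ := Function.update 1 none (-1)
  have ha : ∀ i, a i ≠ 0 := by
    intro i
    cases i <;> simp [a]
  obtain ⟨η₁, hη₁, H₁⟩ := h.exists_separation_aux hf
  obtain ⟨η₂, hη₂, H₂⟩ := h.exists_separation_aux (hf.scale a ha fun k => by simp [a])
  refine ⟨min η₁ η₂, lt_min hη₁ hη₂, fun i j w w' hw hw' hnot hi hj hη hη' => ⟨fun h0 => ?_,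
    fun h0 => ?_⟩⟩
  · exact H₁ i j w w' hw hw' hnot hi hj (hη.trans (min_le_left _ _))
      (hη'.trans (min_le_left _ _)) h0
  · have haa : ∀ y : Option κ → ℝ, (diagEquiv a ha).trans f (a * y) = f y := by
      intro y
      change f (a * (a * y)) = f y
      congr 1
      ext i
      cases i <;> simp [a]
    have hk : ∀ (y : Option κ → ℝ) k, (a * y) (some k) = y (some k) := by simp [a]
    have := H₂ i j (a * w) (a * w') (by rwa [haa]) (by rwa [haa])
      (fun s hs => by rw [← mul_smul_comm, ← mul_add, haa]; exact hnot s hs)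
      (by rwa [hk]) (by rwa [hk]) (by rw [hk]; exact hη.trans (min_le_right _ _))
      (by rw [hk]; exact hη'.trans (min_le_right _ _)) (by simpa [a] using h0)
    simpa [a] using this

end Separation

end IsBenzecriCone

section Compactness

variable {ι V : Type*} [Fintype ι] [NormedAddCommGroup V] [NormedSpace ℝ V]

lemma norm_le_of_forall_norm_le {E F : Type*} [NormedAddCommGroup E] [NormedSpace ℝ E]
    [NormedAddCommGroup F] [NormedSpace ℝ F] (L : E →L[ℝ] F) {ε B : ℝ} (hε : 0 < ε) (hB : 0 ≤ B)
    (h : ∀ v, ‖v‖ ≤ ε → ‖L v‖ ≤ B) : ‖L‖ ≤ B / ε := by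
  refine L.opNorm_le_bound (by positivity) fun v => ?_
  rcases eq_or_ne v 0 with rfl | hv
  · simp
  have hv' : 0 < ‖v‖ := norm_pos_iff.2 hv
  have := h ((ε / ‖v‖) • v) (by
    rw [norm_smul, Real.norm_of_nonneg (by positivity), div_mul_cancel₀ _ hv'.ne'])
  rw [map_smul, norm_smul, Real.norm_of_nonneg (by positivity), div_mul_eq_mul_div,
    div_le_iff₀ hv'] at this
  rw [div_mul_eq_mul_div, le_div_iff₀ hε]
  linarith

lemma norm_le_of_norm_add_sub_le {E : Type*} [NormedAddCommGroup E] [NormedSpace ℝ E]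
    (φ : E →ₗ[ℝ] ℝ) {p u : E} (h1 : ‖p + u‖ ≤ φ (p + u)) (h2 : ‖p - u‖ ≤ φ (p - u)) :
    ‖u‖ ≤ φ p := by
  have h3 : ‖(p + u) - (p - u)‖ ≤ ‖p + u‖ + ‖p - u‖ := norm_sub_le _ _
  rw [show (p + u) - (p - u) = (2 : ℝ) • u by module, norm_smul] at h3
  rw [map_add] at h1
  rw [map_sub] at h2
  norm_num at h3
  linarith

/-- Benzécri's compactness theorem, for cones whose automorphism group acts cocompactly. -/
lemma exists_limit_of_cocompact [FiniteDimensional ℝ V] {C K : Set V} (hC : IsOpen C)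
    (hpt : ∃ φ : V →ₗ[ℝ] ℝ, ∀ y ∈ C, ‖y‖ ≤ φ y) (hK : IsCompact K) (hKC : K ⊆ C)
    (hcov : ∀ y ∈ C, ∃ γ : V ≃L[ℝ] V, (∀ v, γ v ∈ C ↔ v ∈ C) ∧ ∃ k ∈ K, γ k = y)
    (f : ℕ → (ι → ℝ) ≃L[ℝ] V)
    (hU : ∃ U : Set (ι → ℝ), IsOpen U ∧ U.Nonempty ∧ ∀ n, ∀ y ∈ U, f n y ∈ C)
    (hφ : ∃ φ : (ι → ℝ) →ₗ[ℝ] ℝ, ∀ n y, f n y ∈ C → ∀ i, |y i| ≤ φ y) :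
    ∃ (g : (ι → ℝ) ≃L[ℝ] V) (s : ℕ → ℕ), StrictMono s ∧
      (∀ y, g y ∈ C → ∀ᶠ n in atTop, f (s n) y ∈ C) ∧
      (∀ y, (∃ᶠ n in atTop, f (s n) y ∈ C) → g y ∈ closure C) := by
  obtain ⟨U, hUo, ⟨p, hp⟩, hUC⟩ := hU
  obtain ⟨φ, hφ⟩ := hφ
  obtain ⟨ψ, hψ⟩ := hpt
  have hφ' : ∀ n y, f n y ∈ C → ‖y‖ ≤ φ y := fun n y hy => by
    rcases isEmpty_or_nonempty ι with he | ⟨⟨i⟩⟩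
    · simp [Subsingleton.elim y 0]
    · exact (pi_norm_le_iff_of_nonneg ((abs_nonneg _).trans (hφ n y hy i))).2 (hφ n y hy)
  choose γ hγ k hk hγk using fun n => hcov (f n p) (hUC n p hp)
  let G : ℕ → V ≃L[ℝ] (ι → ℝ) := fun n => (γ n).trans (f n).symm
  have hG : ∀ n v, f n (G n v) ∈ C ↔ v ∈ C := fun n v => by simp [G, hγ]
  have hG' : ∀ n y, (G n).symm y ∈ C ↔ f n y ∈ C := fun n y => by
    rw [← hG n, ContinuousLinearEquiv.apply_symm_apply]
  have hGk : ∀ n, G n (k n) = p := fun n => by simp [G, hγk]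
  have hGp : ∀ n, (G n).symm p = k n := fun n => by
    rw [← hGk n, ContinuousLinearEquiv.symm_apply_apply]
  obtain ⟨ε, hε, hεC⟩ := hK.exists_thickening_subset_open hC hKC
  have hGbd : ∀ n, ‖(G n : V →L[ℝ] (ι → ℝ))‖ ≤ φ p / (ε / 2) := by
    intro n
    refine norm_le_of_forall_norm_le _ (by positivity)
      ((norm_nonneg _).trans (hφ' n p (hUC n p hp))) fun v hv => ?_
    have hmem : ∀ u : V, ‖u‖ ≤ ε / 2 → k n + u ∈ C := fun u hu => hεC
      (mem_thickening_iff.2 ⟨k n, hk n, by simpa using by linarith⟩)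
    refine norm_le_of_norm_add_sub_le φ ?_ ?_
    · refine hφ' n _ ?_
      rw [← hGk n]
      simpa [← map_add, hG] using hmem v hv
    · refine hφ' n _ ?_
      rw [← hGk n]
      simpa [← map_sub, hG, ← sub_eq_add_neg] using hmem (-v) (by simpa using hv)
  obtain ⟨δ, hδ, hδU⟩ := Metric.isOpen_iff.1 hUo p hp
  obtain ⟨B, hB⟩ := hK.exists_bound_of_continuousOn
    (ψ.continuous_of_finiteDimensional.continuousOn (s := K))
  have hGbd' : ∀ n, ‖((G n).symm : (ι → ℝ) →L[ℝ] V)‖ ≤ B / (δ / 2) := by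
    intro n
    refine norm_le_of_forall_norm_le _ (by positivity)
      ((norm_nonneg _).trans (hB _ (hk n))) fun u hu => ?_
    have hmem : ∀ u : ι → ℝ, ‖u‖ ≤ δ / 2 → f n (p + u) ∈ C := fun u hu =>
      hUC n _ (hδU (by simpa using by linarith))
    refine (norm_le_of_norm_add_sub_le ψ (p := k n) ?_ ?_).trans
      ((le_abs_self _).trans (hB _ (hk n)))
    · refine hψ _ ?_
      rw [← hGp n]
      simpa [← map_add, hG'] using hmem u hu
    · refine hψ _ ?_
      rw [← hGp n]
      simpa [← map_sub, hG', ← sub_eq_add_neg] using hmem (-u) (by simpa using hu)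
  have hbdd : Bornology.IsBounded
      (closedBall (0 : V →L[ℝ] (ι → ℝ)) (φ p / (ε / 2)) ×ˢ
        closedBall (0 : (ι → ℝ) →L[ℝ] V) (B / (δ / 2))) :=
    isBounded_closedBall.prod isBounded_closedBall
  have : ProperSpace (V →L[ℝ] (ι → ℝ)) := FiniteDimensional.proper ℝ _
  have : ProperSpace ((ι → ℝ) →L[ℝ] V) := FiniteDimensional.proper ℝ _
  obtain ⟨⟨L, H⟩, -, s, hs, hlim⟩ := tendsto_subseq_of_bounded hbdd
    (x := fun n => ((G n : V →L[ℝ] (ι → ℝ)), ((G n).symm : (ι → ℝ) →L[ℝ] V)))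
    fun n => ⟨by simpa using hGbd n, by simpa using hGbd' n⟩
  have hLH : L.comp H = .id ℝ _ := by
    refine tendsto_nhds_unique (((continuous_fst.clm_comp continuous_snd).tendsto
      (L, H)).comp hlim) (tendsto_const_nhds.congr fun n => ?_)
    ext1 y
    simp
  have hHL : H.comp L = .id ℝ _ := by
    refine tendsto_nhds_unique (((continuous_snd.clm_comp continuous_fst).tendsto
      (L, H)).comp hlim) (tendsto_const_nhds.congr fun n => ?_)
    ext1 y
    simp
  have hpoint : ∀ y, Tendsto (fun n => (G (s n)).symm y) atTop (nhds (H y)) := fun y =>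
    ((continuous_snd.clm_apply continuous_const).tendsto (L, H)).comp hlim
  refine ⟨.equivOfInverse H L (fun y => DFunLike.congr_fun hLH y) fun y =>
    DFunLike.congr_fun hHL y, s, hs, fun y hy => ?_, fun y hy => ?_⟩
  · exact ((hpoint y).eventually (hC.mem_nhds hy)).mono fun n hn => (hG' _ _).1 hn
  · exact mem_closure_of_frequently_of_tendsto (hy.mono fun n hn => (hG' _ _).2 hn) (hpoint y)

end Compactness

section Cone

variable {d : ℕ} {Ω : Set (Euc d)}

lemma mem_coneOver_iff {p : Euc d × ℝ} : p ∈ coneOver Ω ↔ 0 < p.2 ∧ p.2⁻¹ • p.1 ∈ Ω := by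
  constructor
  · rintro ⟨t, ht, x, hx, rfl⟩
    simp [ht, inv_smul_smul₀ ht.ne', hx]
  · rintro ⟨h0, h1⟩
    exact ⟨p.2, h0, _, h1, by ext <;> simp [h0.ne']⟩

lemma mk_one_mem_coneOver_iff {x : Euc d} : (x, (1 : ℝ)) ∈ coneOver Ω ↔ x ∈ Ω := by
  simp [mem_coneOver_iff]

lemma smul_mem_coneOver {t : ℝ} (ht : 0 < t) {p : Euc d × ℝ} (hp : p ∈ coneOver Ω) :
    t • p ∈ coneOver Ω := by
  obtain ⟨r, hr, x, hx, rfl⟩ := hp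
  exact ⟨t * r, by positivity, x, hx, by rw [mul_smul]⟩

lemma smul_mem_coneOver_iff {t : ℝ} (ht : 0 < t) {p : Euc d × ℝ} :
    t • p ∈ coneOver Ω ↔ p ∈ coneOver Ω :=
  ⟨fun h => by simpa [inv_smul_smul₀ ht.ne'] using smul_mem_coneOver (inv_pos.2 ht) h,
    smul_mem_coneOver ht⟩

lemma add_mem_coneOver (hconv : Convex ℝ Ω) {p q : Euc d × ℝ} (hp : p ∈ coneOver Ω)
    (hq : q ∈ coneOver Ω) : p + q ∈ coneOver Ω := by
  obtain ⟨r, hr, x, hx, rfl⟩ := hp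
  obtain ⟨t, ht, y, hy, rfl⟩ := hq
  refine ⟨r + t, by positivity, (r / (r + t)) • x + (t / (r + t)) • y,
    hconv hx hy (by positivity) (by positivity) (by field_simp), ?_⟩
  have : r + t ≠ 0 := by positivity
  ext1
  · simp [smul_smul, mul_div_cancel₀ _ this]
  · simp

lemma isOpen_coneOver (hop : IsOpen Ω) : IsOpen (coneOver Ω) := by
  have hc : ContinuousOn (fun p : Euc d × ℝ => p.2⁻¹ • p.1) {p | 0 < p.2} := by
    refine ContinuousOn.smul (ContinuousOn.inv₀ continuous_snd.continuousOn fun p hp => ?_)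
      continuous_fst.continuousOn
    exact (show 0 < p.2 from hp).ne'
  have := hc.isOpen_inter_preimage (isOpen_lt continuous_const continuous_snd) hop
  convert this using 1
  ext p
  exact mem_coneOver_iff

lemma coneOver_pointed (hbd : Bornology.IsBounded Ω) :
    ∃ φ : (Euc d × ℝ) →ₗ[ℝ] ℝ, ∀ y ∈ coneOver Ω, ‖y‖ ≤ φ y := by
  obtain ⟨R, hR0, hR⟩ := hbd.exists_pos_norm_le
  refine ⟨(R + 1) • LinearMap.snd ℝ _ _, ?_⟩
  rintro _ ⟨t, ht, x, hx, rfl⟩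
  rw [norm_smul, Real.norm_of_nonneg ht.le, Prod.norm_def]
  have := hR x hx
  simp only [LinearMap.smul_apply, LinearMap.snd_apply, Prod.smul_snd, smul_eq_mul]
  rw [mul_one, mul_comm]
  refine mul_le_mul_of_nonneg_right (max_le (by linarith) ?_) ht.le
  simpa using hR0.le

lemma coneOver_cocompact {Γ : Subgroup ((Euc d × ℝ) ≃ₗ[ℝ] (Euc d × ℝ))} (hdiv : Divides Ω Γ) :
    ∃ K ⊆ coneOver Ω, IsCompact K ∧ ∀ y ∈ coneOver Ω, ∃ γ : (Euc d × ℝ) ≃L[ℝ] (Euc d × ℝ),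
      (∀ v, γ v ∈ coneOver Ω ↔ v ∈ coneOver Ω) ∧ ∃ k ∈ K, γ k = y := by
  obtain ⟨hpres, -, -, K, hKΩ, hK, hcov⟩ := hdiv
  refine ⟨(fun x => (x, (1 : ℝ))) '' K, ?_, hK.image (by fun_prop), ?_⟩
  · rintro _ ⟨x, hx, rfl⟩
    exact mk_one_mem_coneOver_iff.2 (hKΩ hx)
  · rintro _ ⟨t, ht, x, hx, rfl⟩
    rw [← hcov] at hx
    simp only [mem_iUnion] at hx
    obtain ⟨γ, hγ, k, hk, rfl⟩ := hx
    have hγC : ∀ v, γ v ∈ coneOver Ω ↔ v ∈ coneOver Ω := fun v => by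
      conv_lhs => rw [← hpres γ hγ]
      exact γ.injective.mem_set_image
    have h2 : 0 < (γ (k, 1)).2 :=
      (mem_coneOver_iff.1 ((hγC _).2 (mk_one_mem_coneOver_iff.2 (hKΩ hk)))).1
    have hr : 0 < t * (γ (k, 1)).2⁻¹ := by positivity
    refine ⟨(γ.trans (LinearEquiv.smulOfNeZero ℝ _ _ hr.ne')).toContinuousLinearEquiv,
      fun v => ?_, (k, 1), ⟨k, hk, rfl⟩, ?_⟩
    · simp [smul_mem_coneOver_iff hr, hγC]
    · ext1 <;> simp [projAct, smul_smul, h2.ne']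

lemma coneOver_irreducible {ι : Type*} [Fintype ι] [DecidableEq ι] (hconv : Convex ℝ Ω)
    (hirr : IsIrreducibleDomain Ω) (f : (ι → ℝ) ≃L[ℝ] (Euc d × ℝ)) (J : Finset ι)
    (hJ : J.Nonempty) (hJ' : J ≠ Finset.univ) :
    ∃ x y, f x ∈ coneOver Ω ∧ f y ∈ coneOver Ω ∧ f (J.piecewise x y) ∉ coneOver Ω := by
  by_contra hcon
  push Not at hcon
  let P : Finset ι → (ι → ℝ) →ₗ[ℝ] (ι → ℝ) := fun J =>
    { toFun := fun y => J.piecewise y (0 : ι → ℝ)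
      map_add' := fun x y => by ext i; by_cases hi : i ∈ J <;> simp [hi]
      map_smul' := fun t y => by ext i; by_cases hi : i ∈ J <;> simp [hi] }
  have hPadd : ∀ x, P J x + P Jᶜ x = x := fun x => by
    ext i; by_cases hi : i ∈ J <;> simp [P, hi]
  have hPpw : ∀ x y, P J x + P Jᶜ y = J.piecewise x y := fun x y => by
    ext i; by_cases hi : i ∈ J <;> simp [P, hi]
  let W : Finset ι → Submodule ℝ (Euc d × ℝ) := fun J =>
    (LinearMap.range (P J)).map (f : (ι → ℝ) →ₗ[ℝ] (Euc d × ℝ))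
  let D : Finset ι → Set (Euc d × ℝ) := fun J =>
    (fun x => f (P J x)) '' {x | f x ∈ coneOver Ω}
  have hW : ∀ J i, i ∈ J → W J ≠ ⊥ := by
    intro J i hi hbot
    have : f (P J (Pi.single i 1)) ∈ W J := ⟨_, ⟨_, rfl⟩, rfl⟩
    rw [hbot, Submodule.mem_bot, map_eq_zero_iff _ f.injective] at this
    simpa [P, hi] using congrFun this i
  have hW' : ∀ J i, i ∉ J → W J ≠ ⊤ := by
    intro J i hi htop
    have : f (Pi.single i 1) ∈ W J := htop ▸ Submodule.mem_top
    obtain ⟨_, ⟨y, rfl⟩, hy⟩ := this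
    have := f.injective hy
    simpa [P, hi] using congrFun this i
  obtain ⟨i, hi⟩ := hJ
  obtain ⟨j, hj⟩ : ∃ j, j ∉ J := by
    by_contra hcon
    push Not at hcon
    exact hJ' (Finset.eq_univ_iff_forall.2 hcon)
  have hDW : ∀ J, D J ⊆ W J := by
    rintro J _ ⟨x, -, rfl⟩
    exact ⟨_, ⟨_, rfl⟩, rfl⟩
  have hDconv : ∀ J, Convex ℝ (D J) := by
    rintro J _ ⟨x, hx, rfl⟩ _ ⟨y, hy, rfl⟩ a b ha hb hab
    refine ⟨a • x + b • y, ?_, by simp⟩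
    rcases ha.eq_or_lt with rfl | ha
    · obtain rfl : b = 1 := by linarith
      simpa using hy
    rcases hb.eq_or_lt with rfl | hb
    · obtain rfl : a = 1 := by linarith
      simpa using hx
    simpa using add_mem_coneOver hconv (smul_mem_coneOver ha hx) (smul_mem_coneOver hb hy)
  have hDsmul : ∀ J, ∀ t : ℝ, 0 < t → ∀ c ∈ D J, t • c ∈ D J := by
    rintro J t ht _ ⟨x, hx, rfl⟩
    exact ⟨t • x, by simpa using smul_mem_coneOver ht hx, by simp⟩
  refine hirr ⟨W J, W Jᶜ, D J, D Jᶜ, hW _ i hi, hW _ j (by simpa using hj), hW' _ j hj,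
    hW' _ i (by simpa using hi), ?_, hDW _, hDW _, hDconv _, hDconv _, hDsmul _, hDsmul _, ?_⟩
  · constructor
    · rw [Submodule.disjoint_def]
      rintro _ ⟨_, ⟨x, rfl⟩, rfl⟩ ⟨_, ⟨y, rfl⟩, hxy⟩
      have h1 := f.injective hxy
      have : P J x = 0 := by
        ext k
        by_cases hk : k ∈ J
        · simpa [P, hk] using (congrFun h1 k).symm
        · simp [P, hk]
      simp [this]
    · rw [codisjoint_iff, Submodule.eq_top_iff']
      intro v
      have := hPadd (f.symm v)
      rw [Submodule.mem_sup]
      exact ⟨_, ⟨_, ⟨f.symm v, rfl⟩, rfl⟩, _, ⟨_, ⟨f.symm v, rfl⟩, rfl⟩, by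
        change f _ + f _ = _
        rw [← map_add, this, f.apply_symm_apply]⟩
  · ext v
    constructor
    · intro hv
      exact ⟨_, ⟨f.symm v, by simpa using hv, rfl⟩, _, ⟨f.symm v, by simpa using hv, rfl⟩, by
        rw [← map_add, hPadd, f.apply_symm_apply]⟩
    · rintro ⟨_, ⟨x, hx, rfl⟩, _, ⟨y, hy, rfl⟩, rfl⟩
      rw [← map_add, hPpw]
      exact hcon x y hx hy

lemma isBenzecriCone_coneOver (hbd : Bornology.IsBounded Ω) (hop : IsOpen Ω) (hconv : Convex ℝ Ω)
    (hirr : IsIrreducibleDomain Ω) {Γ : Subgroup ((Euc d × ℝ) ≃ₗ[ℝ] (Euc d × ℝ))}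
    (hdiv : Divides Ω Γ) :
    IsBenzecriCone (Option (Fin d)) (coneOver Ω) where
  isOpen := isOpen_coneOver hop
  add_mem hx hy := add_mem_coneOver hconv hx hy
  smul_mem ht hx := smul_mem_coneOver ht hx
  pointed := coneOver_pointed hbd
  exists_limit f hU hφ := by
    obtain ⟨K, hKC, hK, hcov⟩ := coneOver_cocompact hdiv
    exact exists_limit_of_cocompact (isOpen_coneOver hop) (coneOver_pointed hbd) hK hKC hcov f hU hφ
  irreducible := coneOver_irreducible hconv hirr

end Cone

section FlatChart

variable {d : ℕ} {Ω : Set (Euc d)} {v : Fin d → Euc d}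

lemma mem_convexHull_range_iff {x : Euc d} : x ∈ convexHull ℝ (Set.range v) ↔
    ∃ a : Fin d → ℝ, (∀ k, 0 ≤ a k) ∧ ∑ k, a k = 1 ∧ ∑ k, a k • v k = x := by
  constructor
  · intro hx
    refine convexHull_min (t := {x | ∃ a : Fin d → ℝ, (∀ k, 0 ≤ a k) ∧ ∑ k, a k = 1 ∧
      ∑ k, a k • v k = x}) ?_ ?_ hx
    · rintro _ ⟨k, rfl⟩
      exact ⟨Pi.single k 1, fun m => by by_cases hm : m = k <;> simp [hm],
        by simp, by simp [Pi.single_apply]⟩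
    · rintro _ ⟨a, ha, ha1, rfl⟩ _ ⟨b, hb, hb1, rfl⟩ s t hs ht hst
      refine ⟨s • a + t • b, fun k => ?_, ?_, ?_⟩
      · exact add_nonneg (mul_nonneg hs (ha k)) (mul_nonneg ht (hb k))
      · simp [Finset.sum_add_distrib, ← Finset.mul_sum, ha1, hb1, hst]
      · simp [add_smul, Finset.sum_add_distrib, mul_smul, ← Finset.smul_sum]
  · rintro ⟨a, ha, ha1, hx⟩
    exact mem_convexHull_of_exists_fintype a v ha ha1 (fun k => mem_range_self k) hx

lemma eq_zero_of_sum_smul_mk_eq_zero (hv : AffineIndependent ℝ v) {c : Fin d → ℝ}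
    (hc : ∑ k, c k • (v k, (1 : ℝ)) = 0) (k : Fin d) : c k = 0 := by
  refine hv.eq_zero_of_sum_eq_zero (s := Finset.univ) (w := c) ?_ ?_ k (Finset.mem_univ k)
  · simpa [Prod.snd_sum] using congrArg Prod.snd hc
  · simpa [Prod.fst_sum] using congrArg Prod.fst hc

lemma pos_of_mem_intrinsicInterior (hv : AffineIndependent ℝ v) {a : Fin d → ℝ}
    (ha1 : ∑ k, a k = 1) {x : Euc d} (hx : ∑ k, a k • v k = x)
    (hxi : x ∈ intrinsicInterior ℝ (convexHull ℝ (Set.range v))) (j : Fin d) : 0 < a j := by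
  obtain ⟨x, hxi, rfl⟩ := mem_intrinsicInterior.1 hxi
  have hvj : v j ∈ affineSpan ℝ (convexHull ℝ (Set.range v)) :=
    subset_affineSpan _ _ (subset_convexHull _ _ (mem_range_self j))
  let γ : ℝ → affineSpan ℝ (convexHull ℝ (Set.range v)) := fun τ =>
    ⟨AffineMap.lineMap (v j) (x : Euc d) (1 + τ), AffineMap.lineMap_mem _ hvj x.2⟩
  have hγ : Continuous γ := by
    refine Continuous.subtype_mk ?_ _
    simp only [AffineMap.lineMap_apply_module]
    fun_prop
  have hγ0 : γ 0 = x := by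
    ext1
    simp [γ]
  have hev : ∀ᶠ τ in nhds (0 : ℝ), γ τ ∈ interior ((↑) ⁻¹' (convexHull ℝ (Set.range v)) :
      Set (affineSpan ℝ (convexHull ℝ (Set.range v)))) :=
    hγ.continuousAt.eventually_mem (isOpen_interior.mem_nhds (by rwa [hγ0]))
  obtain ⟨τ, hτ, hτ0⟩ := ((hev.filter_mono nhdsWithin_le_nhds).and
    (eventually_mem_nhdsWithin (s := Ioi (0 : ℝ)))).exists
  have hτ0 : 0 < τ := hτ0
  obtain ⟨c, hc, hc1, hcx⟩ := mem_convexHull_range_iff.1 (mem_preimage.1 (interior_subset hτ))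
  have hz := eq_zero_of_sum_smul_mk_eq_zero hv
    (c := fun k => (1 + τ) * a k - τ * Pi.single (M := fun _ => ℝ) j 1 k - c k) (by
      ext1
      · simp only [γ, AffineMap.lineMap_apply_module, ← hx] at hcx
        simp [Prod.fst_sum, sub_smul, Finset.sum_sub_distrib, mul_smul, ← Finset.smul_sum, hcx,
          Pi.single_apply]
        module
      · simp [Prod.snd_sum, Finset.sum_sub_distrib, ← Finset.mul_sum, ha1, hc1]) j
  simp only [Pi.single_eq_same, mul_one] at hz
  have := hc j
  by_contra hcon
  push Not at hcon
  nlinarith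

/-- Linear coordinates on `ℝ^d × ℝ` adapted to the flat with vertices `v`. -/
structure IsFlatChart (Ω : Set (Euc d)) (v : Fin d → Euc d)
    (f : (Option (Fin d) → ℝ) ≃L[ℝ] (Euc d × ℝ)) : Prop where
  adapted : IsBenzecriCone.IsAdapted (coneOver Ω) f
  vertex : ∀ k, f (Pi.single (some k) 1) = (v k, 1)

lemma sum_smul_mem_coneOver (h : IsBenzecriCone (Option (Fin d)) (coneOver Ω))
    (hv : IsFlatWith Ω v) (hd : 0 < d) {a : Fin d → ℝ} (ha : ∀ k, 0 < a k) :
    ∑ k, a k • (v k, (1 : ℝ)) ∈ coneOver Ω := by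
  have : Nonempty (Fin d) := ⟨⟨0, hd⟩⟩
  obtain ⟨x, hx⟩ := Set.Nonempty.intrinsicInterior (convex_convexHull ℝ (Set.range v))
    ((range_nonempty v).convexHull)
  obtain ⟨b, hb, hb1, hbx⟩ := mem_convexHull_range_iff.1 (intrinsicInterior_subset hx)
  have hxC : ∑ k, b k • (v k, (1 : ℝ)) ∈ coneOver Ω := by
    have := mk_one_mem_coneOver_iff.2 (hv.2.2.1 hx)
    convert this using 1
    ext1
    · simp [Prod.fst_sum, hbx]
    · simp [Prod.snd_sum, hb1]
  have hcl : ∀ k, (v k, (1 : ℝ)) ∈ closure (coneOver Ω) := fun k =>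
    map_mem_closure (f := fun x : Euc d => (x, (1 : ℝ))) (by fun_prop) (hv.2.1 k).1 fun x hx =>
      mk_one_mem_coneOver_iff.2 hx
  have hsum : ∀ (s : Finset (Fin d)) (w : Euc d × ℝ), w ∈ coneOver Ω → ∀ c : Fin d → ℝ,
      (∀ k, 0 ≤ c k) → ∑ k ∈ s, c k • (v k, (1 : ℝ)) + w ∈ coneOver Ω := by
    intro s w hw c hc
    induction s using Finset.induction_on with
    | empty => simpa using hw
    | insert k s hk ih =>
      rw [Finset.sum_insert hk, add_assoc]
      rcases (hc k).eq_or_lt with h0 | h0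
      · simpa [← h0] using ih
      · exact h.closure_add_mem (h.smul_mem_closure h0 (hcl k)) ih
  obtain ⟨k₀, -, hk₀⟩ := Finset.exists_min_image Finset.univ a Finset.univ_nonempty
  have hble : ∀ k, b k ≤ 1 := fun k =>
    hb1 ▸ Finset.single_le_sum (fun i _ => hb i) (Finset.mem_univ k)
  have := hsum Finset.univ _ (h.smul_mem (ha k₀) hxC) (fun k => a k - a k₀ * b k) fun k => by
    have := hk₀ k (Finset.mem_univ k)
    nlinarith [ha k₀, hble k]
  rw [Finset.smul_sum, ← Finset.sum_add_distrib] at this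
  convert this using 2 with k
  rw [smul_smul, ← add_smul, sub_add_cancel]

lemma sum_smul_not_mem_coneOver (hv : IsFlatWith Ω v) {a : Fin d → ℝ} (ha : ∀ k, 0 ≤ a k)
    {j : Fin d} (hj : a j = 0) : ∑ k, a k • (v k, (1 : ℝ)) ∉ coneOver Ω := by
  intro hmem
  rw [mem_coneOver_iff] at hmem
  have h2 : (∑ k, a k • (v k, (1 : ℝ))).2 = ∑ k, a k := by simp [Prod.snd_sum]
  have h1 : (∑ k, a k • (v k, (1 : ℝ))).1 = ∑ k, a k • v k := by simp [Prod.fst_sum]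
  rw [h1, h2] at hmem
  obtain ⟨h0, hx⟩ := hmem
  set t := ∑ k, a k with ht
  have hsum1 : ∑ k, t⁻¹ * a k = 1 := by rw [← Finset.mul_sum, inv_mul_cancel₀ h0.ne']
  have hsumx : ∑ k, (t⁻¹ * a k) • v k = t⁻¹ • ∑ k, a k • v k := by
    simp [Finset.smul_sum, mul_smul]
  by_cases hxi : t⁻¹ • ∑ k, a k • v k ∈ intrinsicInterior ℝ (convexHull ℝ (Set.range v))
  · have := pos_of_mem_intrinsicInterior hv.1 hsum1 hsumx hxi j
    simp [hj] at this
  · refine (hv.2.2.2 ⟨mem_convexHull_range_iff.2 ⟨_, fun k => ?_, hsum1, hsumx⟩, hxi⟩).2 hx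
    exact mul_nonneg (inv_nonneg.2 h0.le) (ha k)

/-- A supporting functional of the cone along the facet of the flat opposite to `v j`. -/
lemma exists_coordinate (h : IsBenzecriCone (Option (Fin d)) (coneOver Ω))
    (hv : IsFlatWith Ω v) (j : Fin d) : ∃ φ : (Euc d × ℝ) →ₗ[ℝ] ℝ,
      (∀ y ∈ coneOver Ω, 0 < φ y) ∧ ∀ k, φ (v k, 1) = if k = j then 1 else 0 := by
  have hd : 0 < d := j.pos
  let b : Fin d → ℝ := fun k => if k = j then 0 else 1
  have hb : ∑ k, b k • (v k, (1 : ℝ)) ∉ coneOver Ω :=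
    sum_smul_not_mem_coneOver hv (j := j) (fun k => by by_cases hk : k = j <;> simp [b, hk])
      (by simp [b])
  have hconv : Convex ℝ (coneOver Ω) := by
    intro x hx y hy s t hs ht hst
    rcases hs.eq_or_lt with rfl | hs
    · obtain rfl : t = 1 := by linarith
      simpa using hy
    rcases ht.eq_or_lt with rfl | ht
    · obtain rfl : s = 1 := by linarith
      simpa using hx
    exact h.add_mem (h.smul_mem hs hx) (h.smul_mem ht hy)
  obtain ⟨φ, hφ⟩ := geometric_hahn_banach_open_point hconv h.isOpen hb
  have hφ0 : ∀ y ∈ coneOver Ω, φ y ≤ 0 := by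
    intro y hy
    by_contra hcon
    push Not at hcon
    have h1 : 0 < (|φ (∑ k, b k • (v k, (1 : ℝ)))| + 1) / φ y := by positivity
    have h2 := hφ _ (h.smul_mem h1 hy)
    rw [map_smul, smul_eq_mul, div_mul_cancel₀ _ hcon.ne'] at h2
    linarith [le_abs_self (φ (∑ k, b k • (v k, (1 : ℝ))))]
  have hcl : ∀ k, φ (v k, (1 : ℝ)) ≤ 0 := by
    intro k
    have hk : (v k, (1 : ℝ)) ∈ closure (coneOver Ω) :=
      map_mem_closure (f := fun x : Euc d => (x, (1 : ℝ))) (by fun_prop) (hv.2.1 k).1 fun x hx =>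
        mk_one_mem_coneOver_iff.2 hx
    exact closure_minimal (t := {y | φ y ≤ 0}) hφ0 (isClosed_le φ.continuous continuous_const) hk
  have hall := sum_smul_mem_coneOver h hv hd (a := fun _ => 1) fun _ => one_pos
  have hle : φ (∑ k, b k • (v k, (1 : ℝ))) ≤ 0 := by
    rw [map_sum]
    refine Finset.sum_nonpos fun k _ => ?_
    by_cases hk : k = j <;> simp [b, hk, hcl k]
  have hge : 0 ≤ φ (∑ k, b k • (v k, (1 : ℝ))) := by
    by_contra hcon
    push Not at hcon
    have hneg := (hφ0 _ hall).lt_of_ne fun h0 => by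
      have := hφ _ hall
      linarith
    have h1 : 0 < φ (∑ k, b k • (v k, (1 : ℝ))) / φ (∑ k, (1 : ℝ) • (v k, (1 : ℝ))) :=
      div_pos_of_neg_of_neg hcon hneg
    have h2 := hφ _ (h.smul_mem h1 hall)
    rw [map_smul, smul_eq_mul, div_mul_cancel₀ _ hneg.ne] at h2
    exact lt_irrefl _ h2
  have hzero := le_antisymm hle hge
  have hk0 : ∀ k, k ≠ j → φ (v k, (1 : ℝ)) = 0 := by
    intro k hk
    rw [map_sum] at hzero
    have := (Finset.sum_eq_zero_iff_of_nonpos fun k _ => by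
      by_cases hk : k = j <;> simp [b, hk, hcl k]).1 hzero k (Finset.mem_univ k)
    simpa [b, hk] using this
  have hneg : ∀ y ∈ coneOver Ω, φ y < 0 := fun y hy => hzero ▸ hφ y hy
  have hj : φ (v j, (1 : ℝ)) < 0 := by
    have := hneg _ hall
    rw [map_sum, Finset.sum_eq_single j (fun k _ hk => by simp [hk0 k hk]) (by simp)] at this
    simpa using this
  refine ⟨(φ (v j, (1 : ℝ)))⁻¹ • (φ : (Euc d × ℝ) →ₗ[ℝ] ℝ), fun y hy => ?_, fun k => ?_⟩
  · exact mul_pos_of_neg_of_neg (inv_neg''.2 hj) (hneg y hy)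
  · by_cases hk : k = j
    · subst hk
      simp [hj.ne]
    · simp [hk, hk0 k hk]

lemma exists_isFlatChart (h : IsBenzecriCone (Option (Fin d)) (coneOver Ω))
    (hv : IsFlatWith Ω v) (hd : 0 < d) : ∃ f, IsFlatChart Ω v f := by
  choose φ hφ hφv using exists_coordinate h hv
  let W : Submodule ℝ (Euc d × ℝ) := Submodule.span ℝ (Set.range fun k => (v k, (1 : ℝ)))
  have hW : W ≠ ⊤ := by
    intro htop
    have h1 : Module.finrank ℝ W ≤ d := by
      simpa [Set.finrank] using finrank_range_le_card (R := ℝ) (fun k => (v k, (1 : ℝ)))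
    rw [htop, finrank_top] at h1
    simp at h1
  obtain ⟨e', he'⟩ : ∃ e, e ∉ W := by
    by_contra hcon
    push Not at hcon
    exact hW (Submodule.eq_top_iff'.2 hcon)
  let e : Euc d × ℝ := e' - ∑ k, φ k e' • (v k, (1 : ℝ))
  have he : e ∉ W := fun hmem => he' ((Submodule.sub_mem_iff_left _ (Submodule.sum_mem _ fun k _ =>
    W.smul_mem _ (Submodule.subset_span (mem_range_self k)))).1 hmem)
  have he0 : e ≠ 0 := fun h0 => he (h0 ▸ W.zero_mem)
  have hφsum : ∀ j (c : Fin d → ℝ), φ j (∑ k, c k • (v k, (1 : ℝ))) = c j := by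
    intro j c
    rw [map_sum]
    simp only [map_smul, hφv, smul_eq_mul]
    simp
  have hφe : ∀ j, φ j e = 0 := fun j => by
    rw [map_sub, hφsum, sub_self]
  let L : (Option (Fin d) → ℝ) →ₗ[ℝ] (Euc d × ℝ) :=
    { toFun := fun y => y none • e + ∑ k, y (some k) • (v k, (1 : ℝ))
      map_add' := fun x y => by
        simp only [Pi.add_apply, add_smul, Finset.sum_add_distrib]
        abel
      map_smul' := fun t y => by
        simp only [Pi.smul_apply, smul_eq_mul, mul_smul, ← Finset.smul_sum, smul_add,
          RingHom.id_apply] }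
  have hφL : ∀ j y, φ j (L y) = y (some j) := fun j y => by
    change φ j (y none • e + _) = _
    rw [map_add, map_smul, hφe, hφsum, smul_zero, zero_add]
  have hinj : Function.Injective L := by
    rw [injective_iff_map_eq_zero]
    intro y hy
    have hk : ∀ k, y (some k) = 0 := fun k => by rw [← hφL k y, hy, map_zero]
    have h0 : y none • e + ∑ k, y (some k) • (v k, (1 : ℝ)) = 0 := hy
    simp only [hk, zero_smul, Finset.sum_const_zero, add_zero] at h0
    ext i
    cases i with
    | none => exact (smul_eq_zero.1 h0).resolve_right he0
    | some k => exact hk k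
  let E := (L.linearEquivOfInjective hinj (by simp)).toContinuousLinearEquiv
  have hE : ∀ y, E y = L y := fun y => rfl
  refine ⟨E, ⟨fun y hy0 hy => ?_, fun y hy k => ?_⟩, fun k => ?_⟩
  · rw [hE]
    change y none • e + _ ∈ _
    rw [hy0, zero_smul, zero_add]
    exact sum_smul_mem_coneOver h hv hd hy
  · rw [← hφL k y, ← hE]
    exact hφ k _ hy
  · rw [hE]
    change Pi.single (M := fun _ => ℝ) (some k) 1 none • e + _ = _
    simp [Pi.single_apply]

namespace IsFlatChart

variable {f : (Option (Fin d) → ℝ) ≃L[ℝ] (Euc d × ℝ)}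

lemma apply_eq (hf : IsFlatChart Ω v f) (y : Option (Fin d) → ℝ) :
    f y = y none • f (Pi.single none 1) + ∑ k, y (some k) • (v k, (1 : ℝ)) := by
  conv_lhs => rw [show y = ∑ i, y i • Pi.single i (1 : ℝ) from pi_eq_sum_univ' y]
  rw [Fintype.sum_option, map_add, map_smul, map_sum]
  simp only [map_smul, hf.vertex]

lemma symm_sum (hf : IsFlatChart Ω v f) (a : Fin d → ℝ) :
    f.symm (∑ k, a k • (v k, (1 : ℝ))) = fun i => i.elim 0 a := by
  rw [ContinuousLinearEquiv.symm_apply_eq, hf.apply_eq]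
  simp

lemma symm_mk (hf : IsFlatChart Ω v f) {a : Fin d → ℝ} (ha1 : ∑ k, a k = 1) :
    f.symm (∑ k, a k • v k, 1) = fun i => i.elim 0 a := by
  rw [← hf.symm_sum]
  congr 1
  ext1
  · simp [Prod.fst_sum]
  · simp [Prod.snd_sum, ha1]

/-- A flat is the part of the domain on a coordinate hyperplane. -/
lemma mem_intrinsicInterior_iff (hf : IsFlatChart Ω v f) (hv : IsFlatWith Ω v) {x : Euc d} :
    x ∈ intrinsicInterior ℝ (convexHull ℝ (Set.range v)) ↔ x ∈ Ω ∧ f.symm (x, 1) none = 0 := by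
  constructor
  · intro hx
    refine ⟨hv.2.2.1 hx, ?_⟩
    obtain ⟨a, -, ha1, rfl⟩ := mem_convexHull_range_iff.1 (intrinsicInterior_subset hx)
    rw [hf.symm_mk ha1]
    rfl
  · rintro ⟨hx, h0⟩
    by_contra hcon
    have hpos := hf.adapted.pos (f.symm (x, 1)) (by simpa [mk_one_mem_coneOver_iff] using hx)
    have heq := hf.apply_eq (f.symm (x, 1))
    rw [h0, zero_smul, zero_add, f.apply_symm_apply] at heq
    refine (hv.2.2.2 ⟨mem_convexHull_range_iff.2 ⟨fun k => f.symm (x, 1) (some k),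
      fun k => (hpos k).le, ?_, ?_⟩, hcon⟩).2 hx
    · simpa [Prod.snd_sum] using (congrArg Prod.snd heq).symm
    · simpa [Prod.fst_sum] using (congrArg Prod.fst heq).symm

lemma vertex_mem_closure (hf : IsFlatChart Ω v f) (hv : IsFlatWith Ω v) (j : Fin d) :
    v j ∈ closure (intrinsicInterior ℝ (convexHull ℝ (Set.range v))) := by
  have hd : (0 : ℝ) < d := by exact_mod_cast j.pos
  let a : ℝ → Fin d → ℝ := fun τ k => (1 - τ) * Pi.single (M := fun _ => ℝ) j 1 k + τ * (d : ℝ)⁻¹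
  have ha1 : ∀ τ, ∑ k, a τ k = 1 := fun τ => by
    simp [a, Finset.sum_add_distrib, ← Finset.mul_sum]
    field_simp
    ring
  have hc : Continuous fun τ => ∑ k, a τ k • v k := by
    simp only [a]
    fun_prop
  have h0 : ∑ k, a 0 k • v k = v j := by simp [a, Pi.single_apply]
  have ht : Tendsto (fun τ => ∑ k, a τ k • v k) (nhdsWithin 0 (Ioo 0 1)) (nhds (v j)) :=
    h0 ▸ hc.continuousAt.mono_left nhdsWithin_le_nhds
  have : (nhdsWithin (0 : ℝ) (Ioo 0 1)).NeBot := left_nhdsWithin_Ioo_neBot one_pos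
  refine mem_closure_of_tendsto ht (eventually_nhdsWithin_of_forall fun τ hτ => ?_)
  rw [hf.mem_intrinsicInterior_iff hv, hf.symm_mk (ha1 τ)]
  refine ⟨?_, rfl⟩
  rw [← mk_one_mem_coneOver_iff, ← f.apply_symm_apply (_, (1 : ℝ)), hf.symm_mk (ha1 τ)]
  refine hf.adapted.mem_of_pos _ rfl fun k => ?_
  have h1 : 0 ≤ (1 - τ) * Pi.single (M := fun _ => ℝ) j 1 k :=
    mul_nonneg (by linarith [hτ.2]) (by by_cases hk : k = j <;> simp [hk])
  have h2 : 0 < τ * (d : ℝ)⁻¹ := mul_pos hτ.1 (inv_pos.2 hd)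
  exact add_pos_of_nonneg_of_pos h1 h2

end IsFlatChart

lemma closure_intrinsicInterior_subset : closure (intrinsicInterior ℝ (convexHull ℝ
    (Set.range v))) ⊆ convexHull ℝ (Set.range v) :=
  closure_minimal intrinsicInterior_subset ((finite_range v).isClosed_convexHull (𝕜 := ℝ))

/-- A flat whose vertices lie on the hyperplane of another one agrees with it. -/
lemma IsFlatChart.eq_of_vertex_eq_zero {v' : Fin d → Euc d}
    {f f' : (Option (Fin d) → ℝ) ≃L[ℝ] (Euc d × ℝ)} (hf : IsFlatChart Ω v f)
    (hv : IsFlatWith Ω v) (hf' : IsFlatChart Ω v' f') (hv' : IsFlatWith Ω v')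
    (h0 : ∀ k, f.symm (v' k, 1) none = 0) :
    intrinsicInterior ℝ (convexHull ℝ (Set.range v')) =
      intrinsicInterior ℝ (convexHull ℝ (Set.range v)) := by
  set c := f.symm (f' (Pi.single none 1)) none with hc
  have key : ∀ y, f.symm (f' y) none = y none * c := by
    intro y
    rw [hf'.apply_eq, map_add, map_smul, map_sum]
    simp only [map_smul, Pi.add_apply, Finset.sum_apply, Pi.smul_apply, h0, smul_eq_mul, mul_zero,
      Finset.sum_const_zero, add_zero, hc]
  have hc0 : c ≠ 0 := by
    intro h
    have := key (f'.symm (f (Pi.single none 1)))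
    simp [h] at this
  ext x
  rw [hf.mem_intrinsicInterior_iff hv, hf'.mem_intrinsicInterior_iff hv']
  have := key (f'.symm (x, 1))
  rw [f'.apply_symm_apply] at this
  rw [this]
  simp [hc0]

lemma abs_symm_mk_sub_le (f : (Option (Fin d) → ℝ) ≃L[ℝ] (Euc d × ℝ)) (x x' : Euc d)
    (i : Option (Fin d)) : |f.symm (x, 1) i - f.symm (x', 1) i| ≤
      ‖(f.symm : (Euc d × ℝ) →L[ℝ] (Option (Fin d) → ℝ))‖ * dist x x' := by
  have h1 : f.symm (x, 1) i - f.symm (x', 1) i = f.symm (x - x', 0) i := by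
    rw [← Pi.sub_apply, ← map_sub]
    simp
  rw [h1, ← Real.norm_eq_abs, dist_eq_norm]
  refine (norm_le_pi_norm _ i).trans ?_
  simpa using (f.symm : (Euc d × ℝ) →L[ℝ] (Option (Fin d) → ℝ)).le_opNorm (x - x', 0)

lemma symm_mk_sum_smul (f : (Option (Fin d) → ℝ) ≃L[ℝ] (Euc d × ℝ)) {a : Fin d → ℝ}
    (ha1 : ∑ k, a k = 1) (i : Option (Fin d)) :
    f.symm (∑ k, a k • v k, 1) i = ∑ k, a k * f.symm (v k, 1) i := by
  have : (∑ k, a k • v k, (1 : ℝ)) = ∑ k, a k • (v k, (1 : ℝ)) := by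
    ext1
    · simp [Prod.fst_sum]
    · simp [Prod.snd_sum, ha1]
  rw [this, map_sum, Finset.sum_apply]
  simp only [map_smul, Pi.smul_apply, smul_eq_mul]

/-- Two flats which are close to each other have nearby vertices. -/
lemma IsFlatChart.exists_surjective {f : (Option (Fin d) → ℝ) ≃L[ℝ] (Euc d × ℝ)}
    (hf : IsFlatChart Ω v f) (hv : IsFlatWith Ω v) (hd : 0 < d) {η : ℝ} (hη : 0 < η) :
    ∃ δ > 0, ∀ v' f', IsFlatWith Ω v' → IsFlatChart Ω v' f' →
      hausdorffDist (closure (intrinsicInterior ℝ (convexHull ℝ (Set.range v'))))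
        (closure (intrinsicInterior ℝ (convexHull ℝ (Set.range v)))) < δ →
      ∃ σ : Fin d → Fin d, Function.Surjective σ ∧ (∀ j, 1 / 2 ≤ f.symm (v' (σ j), 1) (some j)) ∧
        ∀ j m, m ≠ j → f.symm (v' (σ j), 1) (some m) ≤ η := by
  have hd1 : (1 : ℝ) ≤ d := by exact_mod_cast hd
  have : Nonempty (Fin d) := ⟨⟨0, hd⟩⟩
  set N := ‖(f.symm : (Euc d × ℝ) →L[ℝ] (Option (Fin d) → ℝ))‖ with hN
  have hN0 : 0 ≤ N := norm_nonneg _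
  obtain ⟨ε, hε, hε1, hε2⟩ : ∃ ε > 0, d * ε ≤ η ∧ d * ε + d * (d * ε) ≤ 1 / 4 := by
    refine ⟨min η (1 / 8) / (d * d), by positivity, ?_, ?_⟩
    · calc d * (min η (1 / 8) / (d * d)) = min η (1 / 8) / d := by field_simp
        _ ≤ min η (1 / 8) := div_le_self (by positivity) hd1
        _ ≤ η := min_le_left _ _
    · have h1 : d * (d * (min η (1 / 8) / (d * d))) ≤ 1 / 8 := by
        field_simp
        linarith [min_le_right η (1 / 8)]
      have h2 : 0 ≤ d * (min η (1 / 8) / (d * d)) := by positivity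
      nlinarith
  refine ⟨ε / (N + 1), by positivity, fun v' f' hv' hf' hdist => ?_⟩
  set A := closure (intrinsicInterior ℝ (convexHull ℝ (Set.range v')))
  set B := closure (intrinsicInterior ℝ (convexHull ℝ (Set.range v)))
  have hbdd : ∀ w : Fin d → Euc d,
      Bornology.IsBounded (closure (intrinsicInterior ℝ (convexHull ℝ (Set.range w)))) := fun w =>
    ((finite_range w).isCompact_convexHull (𝕜 := ℝ)).isBounded.subset
      closure_intrinsicInterior_subset
  have hfin : hausdorffEDist A B ≠ ⊤ :=
    hausdorffEDist_ne_top_of_nonempty_of_bounded ⟨_, hf'.vertex_mem_closure hv' ⟨0, hd⟩⟩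
      ⟨_, hf.vertex_mem_closure hv ⟨0, hd⟩⟩ (hbdd v') (hbdd v)
  have hclose : ∀ x x' : Euc d, dist x x' < ε / (N + 1) → ∀ i,
      |f.symm (x, 1) i - f.symm (x', 1) i| ≤ ε := by
    intro x x' hx i
    have h1 := (lt_div_iff₀ (by positivity)).1 hx
    have h2 := abs_symm_mk_sub_le f x x' i
    linarith [dist_nonneg (x := x) (y := x')]
  have hY0 : ∀ k m, 0 ≤ f.symm (v' k, 1) (some m) := by
    intro k m
    refine hf.adapted.nonneg _ ?_ m
    rw [f.apply_symm_apply]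
    exact map_mem_closure (f := fun x : Euc d => (x, (1 : ℝ))) (by fun_prop) (hv'.2.1 k).1
      fun x hx => mk_one_mem_coneOver_iff.2 hx
  have hvY : ∀ j m, f.symm (v j, 1) (some m) = if m = j then 1 else 0 := by
    intro j m
    rw [← hf.vertex, f.symm_apply_apply]
    simp [Pi.single_apply]
  have hsum : ∀ k, 1 - d * ε ≤ ∑ m, f.symm (v' k, 1) (some m) := by
    intro k
    obtain ⟨q, hq, hkq⟩ := exists_dist_lt_of_hausdorffDist_lt (hf'.vertex_mem_closure hv' k)
      hdist hfin
    obtain ⟨a, -, ha1, rfl⟩ := mem_convexHull_range_iff.1 (closure_intrinsicInterior_subset hq)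
    calc 1 - d * ε = ∑ m, (f.symm (∑ k, a k • v k, 1) (some m) - ε) := by
          rw [hf.symm_mk ha1]
          simp [Finset.sum_sub_distrib, ha1]
      _ ≤ _ := Finset.sum_le_sum fun m _ => by
          linarith [(abs_le.1 (hclose _ _ hkq (some m))).1]
  have hσ : ∀ j, ∃ k, ∀ m, m ≠ j → f.symm (v' k, 1) (some m) ≤ d * ε := by
    intro j
    obtain ⟨p, hp, hjp⟩ := exists_dist_lt_of_hausdorffDist_lt' (hf.vertex_mem_closure hv j)
      hdist hfin
    obtain ⟨a, ha0, ha1, rfl⟩ := mem_convexHull_range_iff.1 (closure_intrinsicInterior_subset hp)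
    obtain ⟨k, -, hk⟩ : ∃ k ∈ Finset.univ, (d : ℝ)⁻¹ ≤ a k :=
      Finset.exists_le_of_sum_le Finset.univ_nonempty (by simp [ha1, (by positivity : (d : ℝ) ≠ 0)])
    refine ⟨k, fun m hm => ?_⟩
    have h1 := (abs_le.1 (hclose _ _ hjp (some m))).2
    rw [hvY, if_neg hm, sub_zero, symm_mk_sum_smul f ha1] at h1
    have h2 := (Finset.single_le_sum (fun k _ => mul_nonneg (ha0 k) (hY0 k m))
      (Finset.mem_univ k)).trans h1
    have h3 := (mul_le_mul_of_nonneg_right hk (hY0 k m)).trans h2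
    rwa [inv_mul_le_iff₀ (by positivity)] at h3
  choose σ hσ using hσ
  have hhalf : ∀ j, 1 / 2 ≤ f.symm (v' (σ j), 1) (some j) := by
    intro j
    have h1 := hsum (σ j)
    rw [← Finset.add_sum_erase _ _ (Finset.mem_univ j)] at h1
    have h2 : ∑ m ∈ Finset.univ.erase j, f.symm (v' (σ j), 1) (some m) ≤ d * (d * ε) := by
      refine (Finset.sum_le_card_nsmul _ _ (d * ε) fun m hm =>
        hσ j m (Finset.ne_of_mem_erase hm)).trans ?_
      rw [nsmul_eq_mul]
      refine mul_le_mul_of_nonneg_right ?_ (by positivity)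
      exact_mod_cast (Finset.card_le_univ _).trans (by simp)
    linarith
  refine ⟨σ, Finite.injective_iff_surjective.1 fun i j hij => ?_, hhalf,
    fun j m hm => (hσ j m hm).trans hε1⟩
  by_contra hne
  have h1 := hhalf i
  have h2 := hσ j i hne
  rw [hij] at h1
  have : 0 ≤ d * (d * ε) := by positivity
  linarith

end FlatChart

/-- Flats sufficiently close to a given flat agree with it. -/
lemma IsFlatChart.eq_of_close {d : ℕ} {Ω : Set (Euc d)}
    (h : IsBenzecriCone (Option (Fin d)) (coneOver Ω)) (hd : 3 ≤ d) {v : Fin d → Euc d}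
    {f : (Option (Fin d) → ℝ) ≃L[ℝ] (Euc d × ℝ)} (hf : IsFlatChart Ω v f) (hv : IsFlatWith Ω v) :
    ∃ δ > 0, ∀ v', IsFlatWith Ω v' →
      hausdorffDist (closure (intrinsicInterior ℝ (convexHull ℝ (Set.range v'))))
        (closure (intrinsicInterior ℝ (convexHull ℝ (Set.range v)))) < δ →
      intrinsicInterior ℝ (convexHull ℝ (Set.range v')) =
        intrinsicInterior ℝ (convexHull ℝ (Set.range v)) := by
  have hd0 : 0 < d := by omega
  have : Nontrivial (Fin d) := Fin.nontrivial_iff_two_le.2 (by omega)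
  have hthird : ∀ i j : Fin d, ∃ r, r ≠ i ∧ r ≠ j := fun i j => by
    obtain ⟨r, hr⟩ := Finset.exists_mem_notMem_of_card_lt_card (s := {i, j}) (t := Finset.univ)
      ((Finset.card_le_two).trans_lt (by rw [Finset.card_univ, Fintype.card_fin]; omega))
    exact ⟨r, by simpa using hr⟩
  obtain ⟨η, hη, hsep⟩ := h.exists_separation hf.adapted
  obtain ⟨δ, hδ, hclose⟩ := hf.exists_surjective hv hd0 hη
  refine ⟨δ, hδ, fun v' hv' hdist => ?_⟩
  obtain ⟨f', hf'⟩ := exists_isFlatChart h hv' hd0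
  obtain ⟨σ, hσ, hlarge, hsmall⟩ := hclose v' f' hv' hf' hdist
  have hcl : ∀ k, f (f.symm (v' k, 1)) ∈ closure (coneOver Ω) := by
    intro k
    rw [f.apply_symm_apply]
    exact map_mem_closure (f := fun x : Euc d => (x, (1 : ℝ))) (by fun_prop) (hv'.2.1 k).1
      fun x hx => mk_one_mem_coneOver_iff.2 hx
  have hedge : ∀ i j, ∀ s > (0 : ℝ),
      f (f.symm (v' i, 1) + s • f.symm (v' j, 1)) ∉ coneOver Ω := by
    intro i j s hs hmem
    obtain ⟨r, hri, hrj⟩ := hthird i j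
    rw [← map_smul, ← map_add, f.apply_symm_apply, ← hf'.vertex, ← hf'.vertex, ← map_smul,
      ← map_add] at hmem
    simpa [hri, hrj] using hf'.adapted.pos _ hmem r
  have hopp : ∀ i j, i ≠ j →
      (0 < f.symm (v' (σ i), 1) none → f.symm (v' (σ j), 1) none < 0) ∧
      (f.symm (v' (σ i), 1) none < 0 → 0 < f.symm (v' (σ j), 1) none) := fun i j hij =>
    hsep i j _ _ (hcl _) (hcl _) (hedge _ _) (hlarge i) (hlarge j) (hsmall i j hij.symm)
      (hsmall j i hij)
  refine hf.eq_of_vertex_eq_zero hv hf' hv' fun k => ?_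
  obtain ⟨j, rfl⟩ := hσ k
  obtain ⟨m, hmj, -⟩ := hthird j j
  obtain ⟨r, hrj, hrm⟩ := hthird j m
  rcases lt_trichotomy (f.symm (v' (σ j), 1) none) 0 with hneg | h0 | hpos
  · exact absurd ((hopp j r hrj.symm).2 hneg)
      ((hopp m r hrm.symm).1 ((hopp j m hmj.symm).2 hneg)).not_gt
  · exact h0
  · exact absurd ((hopp j r hrj.symm).1 hpos)
      ((hopp m r hrm.symm).2 ((hopp j m hmj.symm).1 hpos)).not_gt

theorem flats_are_isolated {d : ℕ} (Ω : Set (Euc d)) (hne : Ω.Nonempty)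
    (hbd : Bornology.IsBounded Ω) (hop : IsOpen Ω) (hconv : Convex ℝ Ω)
    (hd : 3 ≤ d) (hirr : IsIrreducibleDomain Ω)
    (Γ : Subgroup ((Euc d × ℝ) ≃ₗ[ℝ] (Euc d × ℝ)))
    (htf : TorsionFreeSub Γ) (hdiv : Divides Ω Γ)
    :
    ∀ F : Set (Euc d), IsFlat Ω F → IsIsolatedFlat Ω F := by
  rintro F ⟨v, hv, rfl⟩ ⟨Fs, hFs, hne', hlim⟩
  have h := isBenzecriCone_coneOver hbd hop hconv hirr hdiv
  obtain ⟨f, hf⟩ := exists_isFlatChart h hv (by omega)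
  obtain ⟨δ, hδ, hclose⟩ := hf.eq_of_close h hd hv
  obtain ⟨i, hi⟩ := (hlim.eventually_lt_const hδ).exists
  obtain ⟨v', hv', hi'⟩ := hFs i
  exact hne' i (hi'.trans (hclose v' hv' (hi' ▸ hi)))
end
end
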